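/- Let P be a convex d-polytope that is combinatorially two-orbit of class 2_I, and let j ∈ {0, …, d−1} with j ∉ I. Then j = 0 or j = d−1. -/

import Mathlib

/-! Generic definitions about flags, flag orbits, and abstract polytopes. -/

variable {α : Type*} [PartialOrder α]

/-- Two flags (maximal chains) are in the same orbit of the automorphism group
(the group of order automorphisms) if some order automorphism maps one onto the other. -/
def SameFlagOrbit (Φ Ψ : Flag α) : Prop :=
  ∃ γ : α ≃o α, γ '' (Φ : Set α) = (Ψ : Set α)

/-- The automorphism group has exactly two orbits on the flags. -/
def TwoFlagOrbits (α : Type*) [PartialOrder α] : Prop :=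
  ∃ Φ Ψ : Flag α, ¬ SameFlagOrbit Φ Ψ ∧
    ∀ Ω : Flag α, SameFlagOrbit Ω Φ ∨ SameFlagOrbit Ω Ψ

/-- `Ψ` is the flag `Φ^i`: it differs from `Φ` in exactly the rank-`i` element
(with respect to the rank function `rk`). -/
def IsIAdjacent (rk : α → ℤ) (i : ℤ) (Φ Ψ : Flag α) : Prop :=
  Φ ≠ Ψ ∧ ∀ x : α, rk x ≠ i → (x ∈ Φ ↔ x ∈ Ψ)

/-- A two-orbit polytope (with rank function `rk`, adjacency indices `0, …, n-1`)
is in class `2_I` if, for every flag `Φ` and every `i < n`, the `i`-adjacent flag `Φ^i`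
lies in the same orbit as `Φ` exactly when `i ∈ I`. -/
def InClass (rk : α → ℤ) (n : ℕ) (I : Set ℕ) : Prop :=
  TwoFlagOrbits α ∧
    ∀ (Φ Ψ : Flag α) (i : ℕ), i < n → IsIAdjacent rk i Φ Ψ →
      (SameFlagOrbit Φ Ψ ↔ i ∈ I)

/-- An abstract polytope of rank `d`: a bounded poset, graded by a rank function `rk`
taking values `-1, 0, …, d`, in which every flag (maximal chain) has exactly one element
of each rank, satisfying the diamond condition and strong flag-connectivity. -/
structure IsAbstractPolytope (α : Type*) [PartialOrder α] [BoundedOrder α]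
    (rk : α → ℤ) (d : ℕ) : Prop where
  rk_bot : rk ⊥ = -1
  rk_top : rk ⊤ = d
  rk_strictMono : StrictMono rk
  rk_cover : ∀ x y : α, x ⋖ y → rk y = rk x + 1
  flag_ranks : ∀ (Φ : Flag α) (i : ℤ), -1 ≤ i → i ≤ d → ∃! x, x ∈ Φ ∧ rk x = i
  diamond : ∀ x y : α, x < y → rk y = rk x + 2 →
    ∃ a b : α, a ≠ b ∧ ∀ z : α, (x < z ∧ z < y) ↔ (z = a ∨ z = b)
  connected : ∀ Φ Ψ : Flag α, ∃ (n : ℕ) (c : Fin (n + 1) → Flag α),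
    c 0 = Φ ∧ c (Fin.last n) = Ψ ∧
    (∀ k : Fin n, ∃ i : ℤ, IsIAdjacent rk i (c k.castSucc) (c k.succ)) ∧
    (∀ k, (Φ : Set α) ∩ (Ψ : Set α) ⊆ (c k : Set α))
/-! Definitions about convex polytopes and their face lattices. -/

/-- Euclidean `d`-space. -/
abbrev EucSp (d : ℕ) : Type := EuclideanSpace ℝ (Fin d)

/-- A convex `d`-polytope: the convex hull of a finite set of points of `ℝ^d`,
with nonempty interior. -/
def IsConvexPolytope {d : ℕ} (P : Set (EucSp d)) : Prop :=
  (∃ S : Finset (EucSp d), P = convexHull ℝ (S : Set (EucSp d))) ∧ (interior P).Nonempty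

/-- The face lattice of `P`: the exposed faces of `P` (intersections of `P` with supporting
hyperplanes, together with `∅` and `P` itself), ordered by inclusion. -/
def Faces {d : ℕ} (P : Set (EucSp d)) : Type := {F : Set (EucSp d) // IsExposed ℝ P F}

noncomputable instance {d : ℕ} (P : Set (EucSp d)) : PartialOrder (Faces P) :=
  Subtype.partialOrder _

open scoped Classical

/-- The rank of a face: `-1` for the empty face, and otherwise its affine dimension. -/
noncomputable def faceRank {d : ℕ} {P : Set (EucSp d)} (F : Faces P) : ℤ :=
  if F.1 = ∅ then -1
  else (Module.finrank ℝ (affineSpan ℝ F.1).direction : ℤ)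
set_option linter.unusedSectionVars false

/-- `h` is a sweep over the atoms above `F`: it separates atoms, and inside every `T` an atom
which is not the lowest one has a neighbour that is strictly lower. -/
def SweepDown (ρ : α → ℕ) (F : α) (h : α → ℝ) : Prop :=
  (∀ u v, F < u → F < v → ρ u = ρ F + 1 → ρ v = ρ F + 1 → h u = h v → u = v) ∧
  ∀ T v w, F < v → ρ v = ρ F + 1 → v ≤ T → F < w → ρ w = ρ F + 1 → w ≤ T → h w < h v →
    ∃ e u, v < e ∧ u < e ∧ e ≤ T ∧ ρ e = ρ F + 2 ∧ F < u ∧ ρ u = ρ F + 1 ∧ h u < h v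

/-- The combinatorial properties of face lattices of polytopes used in the proof. -/
structure PP (ρ : α → ℕ) (n : ℕ) : Prop where
  fin : Finite α
  bot : ∃ b, ρ b = 0 ∧ ∀ x, b ≤ x
  top : ∃ t, ρ t = n ∧ ∀ x, x ≤ t
  smono : StrictMono ρ
  interp : ∀ x y, x < y → ρ x + 1 < ρ y → ∃ z, x < z ∧ z < y
  diamond : ∀ x y : α, x < y → ρ y = ρ x + 2 →
    ∃ a b : α, a ≠ b ∧ ∀ z : α, (x < z ∧ z < y) ↔ (z = a ∨ z = b)
  lin : ∀ v w e e', v ≠ w → v < e → v < e' → w < e → w < e' → ρ w = ρ v →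
    ρ e = ρ v + 1 → ρ e' = ρ v + 1 → e = e'
  sweep : ∀ F, ∃ h, SweepDown ρ F h ∧ SweepDown ρ F (fun x => - h x) ∧
    ∀ v, F < v → ρ v = ρ F + 1 → ∃ h', SweepDown ρ v h' ∧
      ∀ e u, v < e → ρ e = ρ F + 2 → F < u → ρ u = ρ F + 1 → u < e → u ≠ v →
        (h u < h v ↔ h' e < 0)

/-- Flags as functions. -/
@[ext] structure Fl (ρ : α → ℕ) (n : ℕ) where
  f : ℕ → α
  mono : Monotone f
  rk : ∀ k, ρ (f k) = min k n

instance (ρ : α → ℕ) (n : ℕ) : CoeFun (Fl ρ n) (fun _ => ℕ → α) := ⟨Fl.f⟩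

variable {ρ : α → ℕ} {n : ℕ}

theorem Fl.ext' {a b : Fl ρ n} (h : ∀ i, a i = b i) : a = b := Fl.ext (funext h)

/-- The adjacent flag. -/
noncomputable def sw (k : ℕ) (a : Fl ρ n) : Fl ρ n :=
  if h : ∃ b : Fl ρ n, b ≠ a ∧ ∀ i, i ≠ k → b i = a i then h.choose else a

theorem sw_of_ne (k : ℕ) (a : Fl ρ n) (i : ℕ) (hi : i ≠ k) : sw k a i = a i := by
  unfold sw
  split_ifs with h
  · exact h.choose_spec.2 i hi
  · rfl

theorem Fl.lt (a : Fl ρ n) {i j : ℕ} (hij : i < j) (hi : i < n) : a i < a j := by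
  refine lt_of_le_of_ne (a.mono hij.le) ?_
  intro h
  have h1 := a.rk i
  have h2 := a.rk j
  rw [h, h2] at h1
  omega

namespace PP
variable (P : PP ρ n)
include P

theorem rk_le (x : α) : ρ x ≤ n := by
  obtain ⟨t, ht, h⟩ := P.top
  rw [← ht]; exact P.smono.monotone (h x)

theorem eq_of_le {x y : α} (h : x ≤ y) (hr : ρ y ≤ ρ x) : x = y := by
  by_contra hne
  have := P.smono (lt_of_le_of_ne h hne)
  omega

theorem lt_of_le {x y : α} (h : x ≤ y) (hr : ρ x < ρ y) : x < y :=
  lt_of_le_of_ne h (fun e => by rw [e] at hr; omega)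

theorem fl_zero (a b : Fl ρ n) : a 0 = b 0 := by
  obtain ⟨t, ht, h⟩ := P.bot
  rw [← P.eq_of_le (h (a 0)) (by rw [a.rk, ht]; omega),
    ← P.eq_of_le (h (b 0)) (by rw [b.rk, ht]; omega)]

theorem fl_top (a b : Fl ρ n) {k l : ℕ} (hk : n ≤ k) (hl : n ≤ l) : a k = b l := by
  obtain ⟨t, ht, h⟩ := P.top
  rw [P.eq_of_le (h (a k)) (by rw [a.rk, ht]; omega),
    P.eq_of_le (h (b l)) (by rw [b.rk, ht]; omega)]

theorem le_top (a : Fl ρ n) (x : α) {k : ℕ} (hk : n ≤ k) : x ≤ a k := by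
  obtain ⟨t, ht, h⟩ := P.top
  rw [P.eq_of_le (h (a k)) (by rw [a.rk, ht]; omega)]; exact h x

theorem sw_triv (k : ℕ) (hk : ¬ (1 ≤ k ∧ k < n)) (a : Fl ρ n) : sw k a = a := by
  apply Fl.ext'
  intro i
  by_cases hi : i = k
  · subst hi
    by_cases h0 : i = 0
    · subst h0; exact P.fl_zero _ _
    · exact P.fl_top _ _ (by omega) (by omega)
  · exact sw_of_ne _ _ _ hi

/-- replacing one element -/
theorem exists_update (a : Fl ρ n) (k : ℕ) (h1 : 1 ≤ k) (h2 : k < n) (z : α)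
    (hz : a (k-1) < z) (hz' : z < a (k+1)) : ∃ b : Fl ρ n, b k = z ∧ ∀ i, i ≠ k → b i = a i := by
  have hρ1 := P.smono hz
  have hρ2 := P.smono hz'
  rw [a.rk] at hρ1 hρ2
  refine ⟨⟨fun i => if i = k then z else a i, ?_, ?_⟩, ?_, ?_⟩
  · apply monotone_nat_of_le_succ
    intro i
    by_cases hi : i = k
    · subst hi; simp; exact hz'.le
    · by_cases hi' : i + 1 = k
      · subst hi'; simp; simpa using hz.le
      · simp [hi, hi']; exact a.mono (by omega)
  · intro i
    by_cases hi : i = k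
    · subst hi; simp; omega
    · simp [hi, a.rk]
  · simp
  · intro i hi; simp [hi]

theorem sw_self_ne (k : ℕ) (h1 : 1 ≤ k) (h2 : k < n) (a : Fl ρ n) : sw k a k ≠ a k := by
  have hex : ∃ b : Fl ρ n, b ≠ a ∧ ∀ i, i ≠ k → b i = a i := by
    obtain ⟨x, y, hxy, h⟩ := P.diamond (a (k-1)) (a (k+1)) (a.lt (by omega) (by omega))
      (by rw [a.rk, a.rk]; omega)
    have : ∃ z, z ≠ a k ∧ a (k-1) < z ∧ z < a (k+1) := by
      by_cases hx : x = a k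
      · exact ⟨y, by rw [← hx]; exact hxy.symm, (h y).2 (Or.inr rfl)⟩
      · exact ⟨x, hx, (h x).2 (Or.inl rfl)⟩
    obtain ⟨z, hz, hz1, hz2⟩ := this
    obtain ⟨b, hb, hb'⟩ := P.exists_update a k h1 h2 z hz1 hz2
    exact ⟨b, fun e => hz (by rw [← hb, e]), hb'⟩
  intro h
  have h3 : sw k a = hex.choose := by unfold sw; rw [dif_pos hex]
  have h4 := hex.choose_spec
  rw [← h3] at h4
  apply h4.1
  apply Fl.ext'
  intro i
  by_cases hi : i = k
  · subst hi; exact h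
  · exact h4.2 i hi

theorem sw_ne (k : ℕ) (h1 : 1 ≤ k) (h2 : k < n) (a : Fl ρ n) : sw k a ≠ a :=
  fun h => P.sw_self_ne k h1 h2 a (by rw [h])

/-- diamond: only two candidates -/
theorem dia {a : Fl ρ n} {k : ℕ} (h1 : 1 ≤ k) (h2 : k < n) {z : α}
    (hz : a (k-1) < z) (hz' : z < a (k+1)) : z = a k ∨ z = sw k a k := by
  obtain ⟨x, y, hxy, h⟩ := P.diamond (a (k-1)) (a (k+1)) (a.lt (by omega) (by omega))
      (by rw [a.rk, a.rk]; omega)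
  have e1 := (h z).1 ⟨hz, hz'⟩
  have e2 := (h (a k)).1 ⟨a.lt (by omega) (by omega), a.lt (by omega) (by omega)⟩
  have e3 := (h (sw k a k)).1 ⟨by
      rw [← sw_of_ne k a (k-1) (by omega)]; exact Fl.lt _ (by omega) (by omega), by
      rw [← sw_of_ne k a (k+1) (by omega)]; exact Fl.lt _ (by omega) (by omega)⟩
  have := P.sw_self_ne k h1 h2 a
  grind

theorem eq_or_sw {a b : Fl ρ n} (k : ℕ) (h : ∀ i, i ≠ k → b i = a i) : b = a ∨ b = sw k a := by
  by_cases hk : 1 ≤ k ∧ k < n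
  · have hd := P.dia (a := a) hk.1 hk.2 (z := b k)
      (by rw [← h _ (by omega)]; exact Fl.lt _ (by omega) (by omega))
      (by rw [← h _ (by omega)]; exact Fl.lt _ (by omega) (by omega))
    rcases hd with hd | hd
    · left; apply Fl.ext'; intro i
      by_cases hi : i = k
      · subst hi; exact hd
      · exact h i hi
    · right; apply Fl.ext'; intro i
      by_cases hi : i = k
      · subst hi; exact hd
      · rw [sw_of_ne _ _ _ hi]; exact h i hi
  · left
    apply Fl.ext'
    intro i
    by_cases hi : i = k
    · subst hi
      by_cases h0 : i = 0
      · subst h0; exact P.fl_zero _ _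
      · exact P.fl_top _ _ (by omega) (by omega)
    · exact h i hi

theorem sw_sw (k : ℕ) (a : Fl ρ n) : sw k (sw k a) = a := by
  by_cases hk : 1 ≤ k ∧ k < n
  · rcases P.eq_or_sw (a := sw k a) (b := a) k (fun i hi => (sw_of_ne _ _ _ hi).symm) with h | h
    · exact absurd h.symm (P.sw_ne k hk.1 hk.2 a)
    · exact h.symm
  · rw [P.sw_triv k hk, P.sw_triv k hk]

theorem sw_loc (k : ℕ) (a b : Fl ρ n) (h0 : a (k-1) = b (k-1)) (h1 : a k = b k)
    (h2 : a (k+1) = b (k+1)) : sw k a k = sw k b k := by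
  by_cases hk : 1 ≤ k ∧ k < n
  · have hd := P.dia (a := a) hk.1 hk.2 (z := sw k b k)
      (by rw [h0, ← sw_of_ne k b (k-1) (by omega)]; exact Fl.lt _ (by omega) (by omega))
      (by rw [h2, ← sw_of_ne k b (k+1) (by omega)]; exact Fl.lt _ (by omega) (by omega))
    rcases hd with hd | hd
    · rw [h1] at hd; exact absurd hd (P.sw_self_ne k hk.1 hk.2 b)
    · exact hd.symm
  · rw [P.sw_triv k hk, P.sw_triv k hk, h1]

theorem sw_comm (k l : ℕ) (hkl : k + 2 ≤ l) (a : Fl ρ n) : sw k (sw l a) = sw l (sw k a) := by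
  apply Fl.ext'
  intro i
  by_cases h1 : i = k
  · subst h1
    rw [sw_of_ne l _ _ (by omega)]
    apply P.sw_loc <;> rw [sw_of_ne _ _ _ (by omega)]
  · by_cases h2 : i = l
    · subst h2
      rw [sw_of_ne k _ _ (by omega)]
      apply P.sw_loc <;> rw [sw_of_ne _ _ _ (by omega)]
    · simp [sw_of_ne, h1, h2]

/-- a maximal chain has all ranks -/
theorem flag_rank (Φ : Flag α) (k : ℕ) (hk : k ≤ n) : ∃ x ∈ Φ, ρ x = k := by
  have := P.fin
  obtain ⟨b, hb, hb'⟩ := P.bot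
  obtain ⟨t, ht, ht'⟩ := P.top
  by_contra hcon
  push Not at hcon
  have memb : ∀ z, (∀ w ∈ Φ, w ≤ z ∨ z ≤ w) → z ∈ Φ := by
    intro z hz
    have hc : IsChain (· ≤ ·) (insert z (Φ : Set α)) := by
      apply Φ.chain_le.insert
      intro w hw _
      exact (hz w hw).symm
    have := Φ.max_chain' hc (Set.subset_insert _ _)
    show z ∈ Φ.carrier
    rw [this]; exact Set.mem_insert _ _
  have hbm : b ∈ Φ := memb b fun w _ => Or.inr (hb' w)
  have htm : t ∈ Φ := memb t fun w _ => Or.inl (ht' w)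
  obtain ⟨x, ⟨hx, hxk⟩, hxm⟩ := Set.exists_max_image {x | x ∈ Φ ∧ ρ x ≤ k} ρ (Set.toFinite _)
    ⟨b, hbm, by omega⟩
  obtain ⟨y, ⟨hy, hyk⟩, hym⟩ := Set.exists_min_image {x | x ∈ Φ ∧ k ≤ ρ x} ρ (Set.toFinite _)
    ⟨t, htm, by omega⟩
  have hx1 := hcon x hx
  have hy1 := hcon y hy
  have cmp : ∀ u ∈ Φ, ∀ w ∈ Φ, ρ u ≤ ρ w → u ≤ w := by
    intro u hu w hw h
    rcases Φ.le_or_le hu hw with h1 | h1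
    · exact h1
    · exact (P.eq_of_le h1 h).ge
  have hxy : x < y := P.lt_of_le (cmp x hx y hy (by omega)) (by omega)
  obtain ⟨z, hz1, hz2⟩ := P.interp x y hxy (by omega)
  have hz : z ∈ Φ := by
    apply memb
    intro w hw
    rcases le_total (ρ w) k with h | h
    · left; exact (cmp w hw x hx (hxm w ⟨hw, h⟩)).trans hz1.le
    · right; exact hz2.le.trans (cmp y hy w hw (hym w ⟨hw, h⟩))
  have r1 := P.smono hz1
  have r2 := P.smono hz2
  rcases le_total (ρ z) k with h | h
  · have := hxm z ⟨hz, h⟩; omega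
  · have := hym z ⟨hz, h⟩; omega

theorem exists_fl (Φ : Flag α) : ∃ a : Fl ρ n, Set.range a.f = (Φ : Set α) := by
  have : Nonempty α := ⟨P.bot.choose⟩
  choose! g hg hg' using fun k (hk : k ≤ n) => P.flag_rank Φ k hk
  have cmp : ∀ u ∈ Φ, ∀ w ∈ Φ, ρ u ≤ ρ w → u ≤ w := by
    intro u hu w hw h
    rcases Φ.le_or_le hu hw with h1 | h1
    · exact h1
    · exact (P.eq_of_le h1 h).ge
  refine ⟨⟨fun k => g (min k n), ?_, ?_⟩, ?_⟩
  · intro i j hij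
    apply cmp _ (hg _ (min_le_right _ _)) _ (hg _ (min_le_right _ _))
    rw [hg' _ (min_le_right _ _), hg' _ (min_le_right _ _)]
    omega
  · intro k; exact hg' _ (min_le_right _ _)
  · ext x
    constructor
    · rintro ⟨k, rfl⟩; exact hg _ (min_le_right _ _)
    · intro hx
      have hx' := P.rk_le x
      refine ⟨ρ x, ?_⟩
      show g (min (ρ x) n) = x
      rw [min_eq_left hx']
      exact le_antisymm (cmp _ (hg _ hx') _ hx (by rw [hg' _ hx']))
        (cmp _ hx _ (hg _ hx') (by rw [hg' _ hx']))

theorem fl_eq_of_range {a : Fl ρ n} {x : α} (h : x ∈ Set.range a.f) : a (ρ x) = x := by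
  obtain ⟨k, rfl⟩ := h
  rw [a.rk]
  rcases le_total k n with h | h
  · rw [min_eq_left h]
  · exact P.fl_top _ _ (by omega) h

theorem exists_fl_through {x y : α} (h : x ≤ y) : ∃ a : Fl ρ n, a (ρ x) = x ∧ a (ρ y) = y := by
  obtain ⟨Φ, h1, h2⟩ := Flag.exists_mem_mem h
  obtain ⟨a, ha⟩ := P.exists_fl Φ
  exact ⟨a, P.fl_eq_of_range (by rw [ha]; exact h1), P.fl_eq_of_range (by rw [ha]; exact h2)⟩

/-- mixing two flags at a common element -/
theorem mix (a b : Fl ρ n) (k : ℕ) (h : a k = b k) :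
    ∃ c : Fl ρ n, (∀ i ≤ k, c i = a i) ∧ ∀ i, k ≤ i → c i = b i := by
  refine ⟨⟨fun i => if i ≤ k then a i else b i, ?_, ?_⟩, ?_, ?_⟩
  · apply monotone_nat_of_le_succ
    intro i
    by_cases h1 : i + 1 ≤ k
    · simp [h1, (by omega : i ≤ k)]; exact a.mono (by omega)
    · by_cases h2 : i ≤ k
      · have : i = k := by omega
        subst this
        simp [h]; exact b.mono (by omega)
      · simp [h1, h2]; exact b.mono (by omega)
  · intro i
    split_ifs
    · exact a.rk i
    · exact b.rk i
  · intro i hi; simp [hi]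
  · intro i hi
    by_cases h1 : i ≤ k
    · have : i = k := by omega
      subst this; simp [h]
    · simp [h1]

/-- modify a flag between `p` and `q` to go through `x`. -/
theorem ext_through (a : Fl ρ n) (p q : ℕ) (hp : p ≤ n) (hq : q ≤ n) (x : α)
    (h1 : a p ≤ x) (h2 : x ≤ a q) :
    ∃ c : Fl ρ n, (∀ i ≤ p, c i = a i) ∧ (∀ i, q ≤ i → c i = a i) ∧ c (ρ x) = x := by
  obtain ⟨b, hb1, hb2⟩ := P.exists_fl_through h1
  obtain ⟨b', hb1', hb2'⟩ := P.exists_fl_through h2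
  have r1 := P.smono.monotone h1
  have r2 := P.smono.monotone h2
  rw [a.rk, min_eq_left hp] at r1 hb1
  rw [a.rk, min_eq_left hq] at r2 hb2'
  obtain ⟨c1, hc1, hc1'⟩ := P.mix a b p hb1.symm
  obtain ⟨c2, hc2, hc2'⟩ := P.mix c1 b' (ρ x) (by rw [hc1' _ r1, hb2, hb1'])
  obtain ⟨c3, hc3, hc3'⟩ := P.mix c2 a q (by rw [hc2' _ r2, hb2'])
  refine ⟨c3, fun i hi => ?_, hc3', ?_⟩
  · rw [hc3 i (by omega), hc2 i (by omega), hc1 i hi]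
  · rw [hc3 _ r2, hc2 _ le_rfl, hc1' _ r1, hb2]

end PP


/-- Reachability by changing elements at positions in `[m, r)`, staying inside `Q`. -/
def Rch (Q : Fl ρ n → Prop) (m r : ℕ) : Fl ρ n → Fl ρ n → Prop :=
  Relation.ReflTransGen (fun a b => Q a ∧ Q b ∧ ∃ k, m ≤ k ∧ k < r ∧ b = sw k a)

theorem Rch.pres {Q : Fl ρ n → Prop} {m r : ℕ} {a b : Fl ρ n} (h : Rch Q m r a b) (i : ℕ)
    (hi : i < m ∨ r ≤ i) : b i = a i := by
  induction h with
  | refl => rfl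
  | tail _ h ih =>
    obtain ⟨_, _, k, hk1, hk2, rfl⟩ := h
    rw [sw_of_ne _ _ _ (by omega), ih]

theorem Rch.upg {Q Q' : Fl ρ n → Prop} {m m' r : ℕ} (hm : m' ≤ m) {a b : Fl ρ n}
    (h : Rch Q m r a b)
    (hQ : ∀ x : Fl ρ n, (∀ i, i < m → x i = a i) → Q' x) : Rch Q' m' r a b := by
  induction h with
  | refl => exact Relation.ReflTransGen.refl
  | tail h1 h ih =>
    refine Relation.ReflTransGen.tail ih ⟨hQ _ fun i hi => Rch.pres h1 i (Or.inl hi),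
      hQ _ fun i hi => Rch.pres (h1.tail h) i (Or.inl hi), ?_⟩
    obtain ⟨_, _, k, hk1, hk2, h⟩ := h
    exact ⟨k, by omega, hk2, h⟩

namespace PP
variable (P : PP ρ n)
include P

theorem rch_symm {Q : Fl ρ n → Prop} {m r : ℕ} {a b : Fl ρ n} (h : Rch Q m r a b) :
    Rch Q m r b a := by
  induction h with
  | refl => exact Relation.ReflTransGen.refl
  | tail h1 h ih =>
    obtain ⟨q1, q2, k, hk1, hk2, rfl⟩ := h
    exact Relation.ReflTransGen.head ⟨q2, q1, k, hk1, hk2, (P.sw_sw _ _).symm⟩ ih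

theorem rch_lift {Q : Fl ρ n → Prop} {m r : ℕ} {a b : Fl ρ n} (h : Rch Q m r a b)
    (hQ : ∀ x y : Fl ρ n, (∀ i ≤ r, x i = y i) → Q x → Q y)
    (a' : Fl ρ n) (ha : ∀ i ≤ r, a' i = a i) : ∃ b', Rch Q m r a' b' ∧ ∀ i ≤ r, b' i = b i := by
  induction h with
  | refl => exact ⟨a', Relation.ReflTransGen.refl, ha⟩
  | @tail b0 _ h1 h ih =>
    obtain ⟨b', hb1, hb2⟩ := ih
    obtain ⟨q1, q2, k, hk1, hk2, rfl⟩ := h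
    have key : ∀ i ≤ r, sw k b' i = sw k b0 i := by
      intro i hi
      by_cases hik : i = k
      · subst hik
        exact P.sw_loc i _ _ (hb2 _ (by omega)) (hb2 _ (by omega)) (hb2 _ (by omega))
      · rw [sw_of_ne _ _ _ hik, sw_of_ne _ _ _ hik, hb2 i hi]
    refine ⟨sw k b', hb1.tail ⟨hQ _ _ (fun i hi => (hb2 i hi).symm) q1,
      hQ _ _ (fun i hi => (key i hi).symm) q2, k, hk1, hk2, rfl⟩, key⟩

/-- Connectedness of sections. -/
def ConnA (_P : PP ρ n) (m r : ℕ) : Prop :=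
  ∀ a b : Fl ρ n, (∀ i < m, a i = b i) → a r = b r →
    ∃ c, Rch (fun _ => True) m r a c ∧ ∀ i ≤ r, c i = b i

theorem descend {m r : ℕ} (hm : 1 ≤ m) (hmr : m < r) (hr : r ≤ n) (IH : P.ConnA (m+1) r)
    (F : α) (h : α → ℝ) (hs : SweepDown ρ F h) (hF : ρ F + 1 = m) (M : ℝ) (w T : α)
    (hw : F < w) (hwr : ρ w = m) (hwT : w ≤ T) :
    ∀ (a : Fl ρ n), a (m-1) = F → a r = T → h (a m) ≤ M → (∀ v, F < v → ρ v = m → v ≤ T → h w ≤ h v) →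
    ∃ c, Rch (fun x => h (x m) ≤ M) m r a c ∧ c m = w := by
  have := P.fin
  have wf : WellFounded (fun x y : α => h x < h y) :=
    @Finite.wellFounded_of_trans_of_irrefl α _ (fun x y : α => h x < h y)
      ⟨fun _ _ _ h1 h2 => h1.trans h2⟩ ⟨fun _ => lt_irrefl _⟩
  intro a
  generalize hv : a m = v
  induction v using wf.induction generalizing a with
  | _ v ih =>
  intro haF haT hM hmin
  have hFv : F < v := by rw [← haF, ← hv]; exact a.lt (by omega) (by omega)
  have hvT : v ≤ T := by rw [← haT, ← hv]; exact a.mono (by omega)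
  have hvr : ρ v = m := by rw [← hv, a.rk]; omega
  by_cases hwv : h w < h v
  · obtain ⟨e, u, h1, h2, h3, h4, h5, h6, h7⟩ := hs.2 T v w hFv (by omega) hvT hw (by omega) hwT hwv
    obtain ⟨b, hb1, hb2, hb3⟩ := P.ext_through a m r (by omega) hr e (by rw [hv]; exact h1.le)
      (by rw [haT]; exact h3)
    rw [h4, (by omega : ρ F + 2 = m + 1)] at hb3
    obtain ⟨c, hc, hc'⟩ := IH a b (fun i hi => (hb1 i (by omega)).symm) (hb2 r le_rfl).symm
    have hcm : c m = v := by rw [hc' m (by omega), hb1 m le_rfl, hv]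
    have hcm1 : c (m+1) = e := by rw [hc' _ (by omega), hb3]
    have hcF : c (m-1) = F := by rw [hc' _ (by omega), hb1 _ (by omega), haF]
    have hcT : c r = T := by rw [hc' r le_rfl, hb2 r le_rfl, haT]
    have hsu : sw m c m = u := by
      rcases P.dia (a := c) (k := m) (by omega) (by omega) (z := u) (by rw [hcF]; exact h5)
        (by rw [hcm1]; exact h2) with h | h
      · rw [h, hcm] at h7; exact absurd h7 (lt_irrefl _)
      · exact h.symm
    obtain ⟨c', hc1, hc2⟩ := ih u h7 (sw m c) hsu (by rw [sw_of_ne _ _ _ (by omega), hcF])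
      (by rw [sw_of_ne _ _ _ (by omega), hcT]) (by linarith) hmin
    refine ⟨c', ?_, hc2⟩
    have e1 : Rch (fun x => h (x m) ≤ M) m r a c :=
      hc.upg (by omega) (fun x hx => by rw [hx m (by omega), hv]; exact hM)
    refine (e1.tail ⟨?_, ?_, m, le_rfl, hmr, rfl⟩).trans hc1
    · show h (c m) ≤ M; rw [hcm]; exact hM
    · show h (sw m c m) ≤ M; rw [hsu]; linarith
  · refine ⟨a, Relation.ReflTransGen.refl, ?_⟩
    rw [hv]
    refine hs.1 v w hFv hw (by omega) (by omega) (le_antisymm (not_lt.1 hwv) (hmin v hFv hvr hvT))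

theorem connB {m r : ℕ} (hm : 1 ≤ m) (hmr : m < r) (hr : r ≤ n) (IH : P.ConnA (m+1) r)
    (h : α → ℝ) (M : ℝ) (a b : Fl ρ n) (hs : SweepDown ρ (a (m-1)) h)
    (hab : ∀ i < m, a i = b i) (habr : a r = b r) (ha : h (a m) ≤ M) (hb : h (b m) ≤ M) :
    ∃ c, Rch (fun x => h (x m) ≤ M) m r a c ∧ ∀ i ≤ r, c i = b i := by
  have := P.fin
  obtain ⟨w, ⟨hw1, hw2, hw3⟩, hw4⟩ := Set.exists_min_image
    {x | a (m-1) < x ∧ ρ x = m ∧ x ≤ a r} h (Set.toFinite _)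
    ⟨a m, a.lt (by omega) (by omega), by rw [a.rk]; omega, a.mono (by omega)⟩
  have hF : ρ (a (m-1)) + 1 = m := by rw [a.rk]; omega
  obtain ⟨a1, ha1, ha1'⟩ := P.descend hm hmr hr IH (a (m-1)) h hs hF M w (a r) hw1 hw2 hw3 a rfl rfl
    ha (fun v h1 h2 h3 => hw4 v ⟨h1, h2, h3⟩)
  obtain ⟨b1, hb1, hb1'⟩ := P.descend hm hmr hr IH (a (m-1)) h hs hF M w (a r) hw1 hw2 hw3 b
    (hab _ (by omega)).symm habr.symm hb (fun v h1 h2 h3 => hw4 v ⟨h1, h2, h3⟩)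
  obtain ⟨c1, hc1, hc1'⟩ := IH a1 b1 (by
    intro i hi
    rcases Nat.lt_succ_iff_lt_or_eq.1 hi with h | h
    · rw [ha1.pres i (Or.inl h), hb1.pres i (Or.inl h), hab i h]
    · rw [h, ha1', hb1']) (by
    rw [ha1.pres r (Or.inr le_rfl), hb1.pres r (Or.inr le_rfl), habr])
  obtain ⟨c2, hc2, hc2'⟩ := P.rch_lift (P.rch_symm hb1) (by
    intro x y hxy hx
    rw [← hxy m (by omega)]; exact hx) c1 hc1'
  refine ⟨c2, (ha1.trans (hc1.upg (by omega) ?_)).trans hc2, hc2'⟩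
  intro x hx
  show h (x m) ≤ M
  rw [hx m (by omega), ha1']
  exact (hw4 (a m) ⟨a.lt (by omega) (by omega), by rw [a.rk]; omega, a.mono (by omega)⟩).trans ha

theorem connA (r : ℕ) (hr : r ≤ n) (m : ℕ) : P.ConnA m r := by
  by_cases hmr : m < r
  · have key : ∀ j, ∀ m, 1 ≤ m → m + j = r → P.ConnA m r := by
      intro j
      induction j with
      | zero =>
        intro m hm h a b hab habr
        refine ⟨a, Relation.ReflTransGen.refl, fun i hi => ?_⟩
        rcases (by omega : i < m ∨ i = r) with h | h
        · exact hab i h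
        · rw [h, habr]
      | succ j ih =>
        intro m hm h a b hab habr
        obtain ⟨hh, hs, -⟩ := P.sweep (a (m-1))
        obtain ⟨c, hc, hc'⟩ := P.connB hm (by omega) hr (ih (m+1) (by omega) (by omega)) hh
          (max (hh (a m)) (hh (b m))) a b hs hab habr (le_max_left _ _) (le_max_right _ _)
        exact ⟨c, hc.upg le_rfl (fun _ _ => trivial), hc'⟩
    by_cases h0 : 1 ≤ m
    · exact key (r - m) m h0 (by omega)
    · intro a b hab habr
      obtain ⟨c, hc, hc'⟩ := key (r-1) 1 le_rfl (by omega) a b (by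
        intro i hi
        have : i = 0 := by omega
        rw [this]; exact P.fl_zero _ _) habr
      exact ⟨c, hc.upg (by omega) (fun _ _ => trivial), hc'⟩
  · intro a b hab habr
    refine ⟨a, Relation.ReflTransGen.refl, fun i hi => ?_⟩
    rcases (by omega : i < m ∨ i = r) with h | h
    · exact hab i h
    · rw [h, habr]

theorem conn_top (m : ℕ) (a b : Fl ρ n) (hab : ∀ i < m, a i = b i) :
    Rch (fun _ => True) m n a b := by
  obtain ⟨c, hc, hc'⟩ := P.connA n le_rfl m a b hab (P.fl_top _ _ le_rfl le_rfl)
  have : c = b := by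
    apply Fl.ext'
    intro i
    rcases le_total i n with h | h
    · exact hc' i h
    · exact P.fl_top _ _ h h
  rwa [this] at hc

theorem connB_top {m : ℕ} (hm : 1 ≤ m) (hmr : m < n)
    (h : α → ℝ) (M : ℝ) (a b : Fl ρ n) (hs : SweepDown ρ (a (m-1)) h)
    (hab : ∀ i < m, a i = b i) (ha : h (a m) ≤ M) (hb : h (b m) ≤ M) :
    Rch (fun x => h (x m) ≤ M) m n a b := by
  obtain ⟨c, hc, hc'⟩ := P.connB hm hmr le_rfl (P.connA n le_rfl (m+1)) h M a b hs hab
    (P.fl_top _ _ le_rfl le_rfl) ha hb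
  have : c = b := by
    apply Fl.ext'
    intro i
    rcases le_total i n with h | h
    · exact hc' i h
    · exact P.fl_top _ _ h h
  rwa [this] at hc

/-- An equivariant map on flags induces an automorphism. -/
theorem exists_aut (D D' : Fl ρ n → Fl ρ n) (hD : ∀ a k, D (sw k a) = sw k (D a))
    (hD' : ∀ a k, D' (sw k a) = sw k (D' a)) (a0 : Fl ρ n) (h0 : D' (D a0) = a0)
    (h0' : D (D' (D a0)) = D a0) :
    ∃ γ : α ≃o α, ∀ (a : Fl ρ n) i, γ (a i) = D a i := by
  have hinv : ∀ D D' : Fl ρ n → Fl ρ n, (∀ a k, D (sw k a) = sw k (D a)) →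
      (∀ a k, D' (sw k a) = sw k (D' a)) → ∀ a0, D' (D a0) = a0 → ∀ a, D' (D a) = a := by
    intro D D' hD hD' a0 h0 a
    have := P.conn_top 0 a0 a (by omega)
    induction this with
    | refl => exact h0
    | tail _ h ih =>
      obtain ⟨_, _, k, _, _, rfl⟩ := h
      rw [hD, hD', ih]
  have hw : ∀ D : Fl ρ n → Fl ρ n, (∀ a k, D (sw k a) = sw k (D a)) → ∀ i ≤ n, ∀ a b : Fl ρ n,
      a i = b i → D a i = D b i := by
    intro D hD i hi a b hab
    obtain ⟨c, hc, hc'⟩ := P.connA i hi 0 a b (by omega) hab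
    have e1 : D c i = D a i := by
      clear hc'
      induction hc with
      | refl => rfl
      | tail _ h ih =>
        obtain ⟨_, _, k, _, _, rfl⟩ := h
        rw [hD, sw_of_ne _ _ _ (by omega), ih]
    have h2 := P.conn_top (i+1) c b (fun j hj => hc' j (by omega))
    have e2 : D b i = D c i := by
      clear e1 hab hc hc'
      induction h2 with
      | refl => rfl
      | tail _ h ih =>
        obtain ⟨_, _, k, _, _, rfl⟩ := h
        rw [hD, sw_of_ne _ _ _ (by omega), ih]
    rw [← e1, e2]
  choose fl hfl using fun x : α => P.exists_fl_through (le_refl x)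
  have val : ∀ D : Fl ρ n → Fl ρ n, (∀ a k, D (sw k a) = sw k (D a)) →
      ∀ (a : Fl ρ n) x, a (ρ x) = x → D (fl x) (ρ x) = D a (ρ x) := by
    intro D hD a x hx
    exact hw D hD _ (P.rk_le x) _ _ (by rw [(hfl x).1, hx])
  have mon : ∀ D : Fl ρ n → Fl ρ n, (∀ a k, D (sw k a) = sw k (D a)) →
      ∀ x y, x ≤ y → D (fl x) (ρ x) ≤ D (fl y) (ρ y) := by
    intro D hD x y hxy
    obtain ⟨a, ha1, ha2⟩ := P.exists_fl_through hxy
    rw [val D hD a x ha1, val D hD a y ha2]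
    exact (D a).mono (P.smono.monotone hxy)
  have inv : ∀ D D' : Fl ρ n → Fl ρ n, (∀ a k, D (sw k a) = sw k (D a)) →
      (∀ a k, D' (sw k a) = sw k (D' a)) → (∀ a, D' (D a) = a) → ∀ x,
      D' (fl (D (fl x) (ρ x))) (ρ (D (fl x) (ρ x))) = x := by
    intro D D' hD hD' h x
    have hr : ρ (D (fl x) (ρ x)) = ρ x := by rw [(D (fl x)).rk]; exact min_eq_left (P.rk_le x)
    rw [val D' hD' (D (fl x)) _ (by rw [hr]), h, hr, (hfl x).1]
  have i1 := inv D D' hD hD' (hinv D D' hD hD' a0 h0)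
  have i2 := inv D' D hD' hD (hinv D' D hD' hD (D a0) h0')
  refine ⟨⟨⟨fun x => D (fl x) (ρ x), fun x => D' (fl x) (ρ x), i1, i2⟩, ?_⟩, ?_⟩
  · intro x y
    constructor
    · intro hxy
      have := mon D' hD' _ _ hxy
      simp only [Equiv.coe_fn_mk] at this
      rwa [i1, i1] at this
    · exact mon D hD x y
  · intro a i
    have hai : a (ρ (a i)) = a i := P.fl_eq_of_range ⟨i, rfl⟩
    show D (fl (a i)) (ρ (a i)) = D a i
    rw [val D hD a _ hai, a.rk]
    rcases le_total i n with h | h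
    · rw [min_eq_left h]
    · exact P.fl_top _ _ (by omega) h

end PP


/-- one rotation step -/
noncomputable def rot (k : ℕ) (a : Fl ρ n) : Fl ρ n := sw (k+1) (sw k a)

/-- The Schläfli-type hypothesis: sizes of polygonal sections depend only on the rank. -/
def Equi (ρ : α → ℕ) (n : ℕ) : Prop :=
  ∀ k q, ∀ a b : Fl ρ n, (rot k)^[q] a = a → (rot k)^[q] b = b

namespace PP
variable (P : PP ρ n)
include P

theorem rot_ne (k : ℕ) (h1 : 1 ≤ k) (h2 : k + 1 < n) (q : ℕ) :
    ∀ a : Fl ρ n, (rot k)^[q] a ≠ sw (k+1) a := by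
  induction q using Nat.strong_induction_on with
  | _ q ih =>
  intro a h
  match q with
  | 0 => exact P.sw_ne (k+1) (by omega) h2 a h.symm
  | 1 =>
    have h' : sw (k+1) (sw k a) = sw (k+1) a := h
    have := congrArg (sw (k+1)) h'
    rw [P.sw_sw, P.sw_sw] at this
    exact P.sw_ne k (by omega) (by omega) a this
  | q+2 =>
    apply ih q (by omega) (rot k a)
    rw [Function.iterate_succ_apply, Function.iterate_succ_apply'] at h
    have h' : sw (k+1) (sw k ((rot k)^[q] (rot k a))) = sw (k+1) a := h
    have := congrArg (sw k) (congrArg (sw (k+1)) h')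
    rw [P.sw_sw, P.sw_sw, P.sw_sw] at this
    rw [this]
    show _ = sw (k+1) (sw (k+1) (sw k a))
    rw [P.sw_sw]

theorem fl_finite : Finite (Fl ρ n) := by
  have := P.fin
  refine Finite.of_injective (fun (a : Fl ρ n) (i : Fin (n+1)) => a i) ?_
  intro a b h
  apply Fl.ext'
  intro i
  rcases Nat.lt_or_ge i (n+1) with h1 | h1
  · exact congrFun h ⟨i, h1⟩
  · exact P.fl_top _ _ (by omega) (by omega)

theorem rot_inj (k : ℕ) : Function.Injective (rot k : Fl ρ n → Fl ρ n) := by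
  intro a b h
  have := congrArg (sw k) (congrArg (sw (k+1)) h)
  simp only [rot] at this
  rwa [P.sw_sw, P.sw_sw, P.sw_sw, P.sw_sw] at this

theorem rot_period (k : ℕ) (a : Fl ρ n) : ∃ q, 1 ≤ q ∧ (rot k)^[q] a = a := by
  have := P.fl_finite
  have hp := (P.rot_inj k).mem_periodicPts a
  obtain ⟨q, hq, h⟩ := hp
  exact ⟨q, hq, h⟩

theorem rot_pres (k : ℕ) (a : Fl ρ n) (q i : ℕ) (h1 : i ≠ k) (h2 : i ≠ k+1) :
    (rot k)^[q] a i = a i := by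
  induction q with
  | zero => rfl
  | succ q ih =>
    rw [Function.iterate_succ_apply']
    show sw (k+1) (sw k ((rot k)^[q] a)) i = _
    rw [sw_of_ne _ _ _ h2, sw_of_ne _ _ _ h1, ih]

/-- If both edges at the vertex in a 2-face are descending, then the vertex is the highest one. -/
theorem max_vertex {F : α} {h : α → ℝ} (hs : SweepDown ρ F (fun x => - h x)) {v e1 e2 u1 u2 T : α}
    (hv : F < v) (hvr : ρ v = ρ F + 1) (hT : ρ T = ρ F + 3) (he : e1 ≠ e2)
    (h1 : v < e1) (h2 : v < e2) (h1T : e1 < T) (h2T : e2 < T)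
    (hu1 : F < u1) (hu1e : u1 < e1) (hu2 : F < u2) (hu2e : u2 < e2)
    (hl1 : h u1 < h v) (hl2 : h u2 < h v) (hr1 : ρ e1 = ρ F + 2) (hr2 : ρ e2 = ρ F + 2)
    {w : α} (hw : F < w) (hwr : ρ w = ρ F + 1) (hwT : w ≤ T) : h w ≤ h v := by
  by_contra hcon
  push Not at hcon
  obtain ⟨e, u, k1, k2, k3, k4, k5, k6, k7⟩ := hs.2 T v w hv hvr (h1.trans h1T).le hw hwr hwT
    (by simpa using hcon)
  have k7 : h v < h u := by simpa using k7
  have heT : e < T := P.lt_of_le k3 (by omega)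
  obtain ⟨x, y, hxy, hd⟩ := P.diamond v T (h1.trans h1T) (by omega)
  have d1 := (hd e).1 ⟨k1, heT⟩
  have d2 := (hd e1).1 ⟨h1, h1T⟩
  have d3 := (hd e2).1 ⟨h2, h2T⟩
  have hee : e = e1 ∨ e = e2 := by grind
  have fin : ∀ e' u', F < u' → u' < e' → h u' < h v → v < e' → ρ e' = ρ F + 2 → u < e' → False := by
    intro e' u' p1 p2 p3 p4 p5 p6
    obtain ⟨x, y, hxy, hd⟩ := P.diamond F e' (hv.trans p4) (by omega)
    have d1 := (hd u).1 ⟨k5, p6⟩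
    have d2 := (hd u').1 ⟨p1, p2⟩
    have d3 := (hd v).1 ⟨hv, p4⟩
    have n1 : u ≠ v := fun h => by rw [h] at k7; exact lt_irrefl _ k7
    have n2 : u' ≠ v := fun h => by rw [h] at p3; exact lt_irrefl _ p3
    have n3 : u ≠ u' := fun h => by rw [h] at k7; exact lt_asymm k7 p3
    grind
  rcases hee with rfl | rfl
  · exact fin e u1 hu1 hu1e hl1 h1 hr1 k2
  · exact fin e u2 hu2 hu2e hl2 h2 hr2 k2

/-- developing maps -/
def Dev (_P : PP ρ n) (m : ℕ) : Prop :=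
  ∀ a b : Fl ρ n, ∃ D : Fl ρ n → Fl ρ n, D a = b ∧
    ∀ c : Fl ρ n, (∀ i < m, c i = a i) → ∀ k, m ≤ k → D (sw k c) = sw k (D c)

/-- Going around a 2-face. -/
theorem around (hE : Equi ρ n) {m : ℕ} (hm : 1 ≤ m) (hmn : m + 1 < n) (S : Set α)
    (a : Fl ρ n) (hS : ∀ w, a (m-1) < w → ρ w = m → w ≤ a (m+2) → w ≠ a m → w ∈ S)
    (D : Fl ρ n → Fl ρ n)
    (hD : ∀ c : Fl ρ n, (∀ i < m, c i = a i) → c m ∈ S → ∀ k, m < k → D (sw k c) = sw k (D c))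
    (hD' : ∀ c : Fl ρ n, (∀ i < m, c i = a i) → c m ∈ S → sw m c m ∈ S → D (sw m c) = sw m (D c))
    (b : Fl ρ n) (hb : D (sw m a) = sw m b) :
    D (sw m (sw (m+1) a)) = sw m (sw (m+1) b) := by
  have hex : ∃ q, 1 ≤ q ∧ (rot m)^[q] a m = a m := by
    obtain ⟨q, h1, h2⟩ := P.rot_period m a
    exact ⟨q, h1, by rw [h2]⟩
  obtain ⟨hq1, hq2⟩ := Nat.find_spec hex
  have hqm := fun q' => @Nat.find_min _ _ hex q'
  generalize Nat.find hex = q at hq1 hq2 hqm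
  have hlow : ∀ q' i, i < m → (rot m)^[q'] a i = a i := fun q' i hi =>
    P.rot_pres m a q' i (by omega) (by omega)
  have hmemS : ∀ q', 1 ≤ q' → q' < q → (rot m)^[q'] a m ∈ S := by
    intro q' h1 h2
    apply hS
    · rw [← hlow q' (m-1) (by omega)]; exact Fl.lt _ (by omega) (by omega)
    · rw [((rot m)^[q'] a).rk]; omega
    · rw [← P.rot_pres m a q' (m+2) (by omega) (by omega)]; exact Fl.mono _ (by omega)
    · intro h; exact hqm q' h2 ⟨h1, h⟩
  have hswm : ∀ c : Fl ρ n, sw m c m = rot m c m := fun c => by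
    unfold rot; rw [sw_of_ne (m+1) _ _ (by omega)]
  have hq1' : q ≠ 1 := by
    intro h
    subst h
    have : rot m a m = a m := hq2
    rw [← hswm] at this
    exact P.sw_self_ne m hm (by omega) a this
  have hqa : (rot m)^[q] a = a := by
    have := P.eq_or_sw (a := a) (b := (rot m)^[q] a) (m+1) (fun i hi => by
      by_cases h : i = m
      · rw [h, hq2]
      · exact P.rot_pres m a q i h hi)
    rcases this with h | h
    · exact h
    · exact absurd h (P.rot_ne m hm hmn q a)
  have hqb := hE m q a b hqa
  have main : ∀ q', 1 ≤ q' → q' < q → D ((rot m)^[q'] a) = (rot m)^[q'] b := by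
    intro q' h1
    induction q', h1 using Nat.le_induction with
    | base =>
      intro h2
      show D (sw (m+1) (sw m a)) = sw (m+1) (sw m b)
      rw [hD _ _ _ _ (by omega), hb]
      · intro i hi; rw [sw_of_ne _ _ _ (by omega)]
      · rw [hswm]; exact hmemS 1 le_rfl h2
    | succ q' h1 ih =>
      intro h2
      rw [Function.iterate_succ_apply', Function.iterate_succ_apply']
      show D (sw (m+1) (sw m ((rot m)^[q'] a))) = sw (m+1) (sw m ((rot m)^[q'] b))
      have hs : sw m ((rot m)^[q'] a) m ∈ S := by
        rw [hswm, ← Function.iterate_succ_apply' (rot m)]; exact hmemS (q'+1) (by omega) h2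
      rw [hD _ _ hs _ (by omega), hD' _ (hlow q') (hmemS q' h1 (by omega)) hs, ih (by omega)]
      intro i hi; rw [sw_of_ne _ _ _ (by omega)]; exact hlow q' i hi
  obtain ⟨p, rfl⟩ : ∃ p, q = p + 1 := ⟨q - 1, by omega⟩
  have inv : ∀ c : Fl ρ n, (rot m)^[p+1] c = c → (rot m)^[p] c = sw m (sw (m+1) c) := by
    intro c hc
    rw [Function.iterate_succ_apply'] at hc
    have hc : sw (m+1) (sw m ((rot m)^[p] c)) = c := hc
    have := congrArg (sw m) (congrArg (sw (m+1)) hc)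
    rwa [P.sw_sw, P.sw_sw] at this
  rw [← inv a hqa, ← inv b hqb]
  exact main p (by omega) (by omega)

end PP


/-- `D` is equivariant on the flags extending `a0` below rank `m` with rank `m` element in `S`. -/
def PE (m : ℕ) (a0 : Fl ρ n) (S : Set α) (D : Fl ρ n → Fl ρ n) : Prop :=
  ∀ c : Fl ρ n, (∀ i < m, c i = a0 i) → c m ∈ S →
    (∀ k, m < k → D (sw k c) = sw k (D c)) ∧ (sw m c m ∈ S → D (sw m c) = sw m (D c))

namespace PP
variable (P : PP ρ n)
include P

theorem sw_gt (c : Fl ρ n) {m : ℕ} (hm : 1 ≤ m) (hmn : m < n) : c (m-1) < sw m c m ∧ sw m c m < c (m+1) := by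
  constructor
  · rw [← sw_of_ne m c (m-1) (by omega)]; exact Fl.lt _ (by omega) (by omega)
  · rw [← sw_of_ne m c (m+1) (by omega)]; exact Fl.lt _ (by omega) (by omega)

theorem ext_step (hE : Equi ρ n) {m : ℕ} (hm : 1 ≤ m) (hmn : m < n) (IH : P.Dev (m+1))
    (a0 : Fl ρ n) (h h' : α → ℝ) (v : α)
    (hs1 : SweepDown ρ (a0 (m-1)) h) (hs2 : SweepDown ρ (a0 (m-1)) (fun x => - h x))
    (hs' : SweepDown ρ v h')
    (hh : ∀ e u, v < e → ρ e = ρ (a0 (m-1)) + 2 → a0 (m-1) < u → ρ u = ρ (a0 (m-1)) + 1 → u < e →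
      u ≠ v → (h u < h v ↔ h' e < 0))
    (Ω0 : Fl ρ n) (hΩ : ∀ i < m, Ω0 i = a0 i) (hΩv : Ω0 m = v) (hΩl : h (sw m Ω0 m) < h v)
    (D : Fl ρ n → Fl ρ n) (hD : PE m a0 {w | h w < h v} D) :
    ∃ D', PE m a0 {w | h w ≤ h v} D' ∧ ∀ c : Fl ρ n, h (c m) < h v → D' c = D c := by
  obtain ⟨Dv, hDv, hDv'⟩ := IH Ω0 (sw m (D (sw m Ω0)))
  have hF : ρ (a0 (m-1)) = m - 1 := by rw [a0.rk]; omega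
  have agr : ∀ c : Fl ρ n, (∀ i < m, c i = a0 i) → c m = v → ∀ i < m+1, c i = Ω0 i := by
    intro c h1 h2 i hi
    by_cases him : i = m
    · rw [him, h2, hΩv]
    · rw [h1 i (by omega), hΩ i (by omega)]
  have lowF : ∀ c : Fl ρ n, (∀ i < m, c i = a0 i) → c (m-1) = a0 (m-1) := fun c hc => hc _ (by omega)
  have swne : ∀ c : Fl ρ n, (∀ i < m, c i = a0 i) → ∀ k, m ≤ k → ∀ i < m, sw k c i = a0 i := by
    intro c hc k hk i hi; rw [sw_of_ne _ _ _ (by omega)]; exact hc i hi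
  have atom : ∀ c : Fl ρ n, (∀ i < m, c i = a0 i) → a0 (m-1) < c m ∧ ρ (c m) = ρ (a0 (m-1)) + 1 := by
    intro c hc
    rw [← lowF c hc, c.rk, c.rk]
    exact ⟨c.lt (by omega) (by omega), by omega⟩
  have hvm := atom Ω0 hΩ
  rw [hΩv] at hvm
  have KEY : ∀ c : Fl ρ n, (∀ i < m, c i = a0 i) → c m = v → h (sw m c m) < h v →
      D (sw m c) = sw m (Dv c) := by
    have base : D (sw m Ω0) = sw m (Dv Ω0) := by rw [hDv, P.sw_sw]
    intro c hc hcv hcl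
    by_cases hmn1 : m + 1 = n
    · have : c = Ω0 := by
        apply Fl.ext'
        intro i
        rcases Nat.lt_or_ge i (m+1) with h1 | h1
        · exact agr c hc hcv i h1
        · exact P.fl_top _ _ (by omega) (by omega)
      rw [this]; exact base
    have low : ∀ x : Fl ρ n, (∀ i < m, x i = a0 i) → x m = v → (h (sw m x m) < h v ↔ h' (x (m+1)) < 0) := by
      intro x hx hxv
      have h1 := atom _ (swne x hx m le_rfl)
      refine hh (x (m+1)) (sw m x m) ?_ ?_ h1.1 h1.2 (P.sw_gt x hm hmn).2 ?_
      · rw [← hxv]; exact x.lt (by omega) (by omega)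
      · rw [x.rk, hF]; omega
      · rw [← hxv]; exact P.sw_self_ne m hm hmn x
    have l1 := (low c hc hcv).1 hcl
    have l2 := (low Ω0 hΩ hΩv).1 hΩl
    have hM : max (h' (Ω0 (m+1))) (h' (c (m+1))) < 0 := max_lt l2 l1
    have path := P.connB_top (m := m+1) (by omega) (by omega) h' _ Ω0 c
      (by rw [Nat.add_sub_cancel, hΩv]; exact hs') (fun i hi => (agr c hc hcv i hi).symm)
      (le_max_left _ _) (le_max_right (h' (Ω0 (m+1))) (h' (c (m+1))))
    clear hc hcv hcl l1
    generalize max (h' (Ω0 (m+1))) (h' (c (m+1))) = M at hM path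
    induction path with
    | refl => exact base
    | @tail x y p1 p2 ih =>
      obtain ⟨q1, q2, k, hk1, hk2, rfl⟩ := p2
      have hpr := fun i hi => Rch.pres p1 i (Or.inl hi)
      have hx : ∀ i < m, x i = a0 i := fun i hi => by rw [hpr i (by omega), hΩ i hi]
      have hxv : x m = v := by rw [hpr m (by omega), hΩv]
      have hxl := (low x hx hxv).2 (lt_of_le_of_lt q1 hM)
      have hyl := (low (sw k x) (swne x hx k (by omega)) (by rw [sw_of_ne _ _ _ (by omega), hxv])).2
        (lt_of_le_of_lt q2 hM)
      rw [hDv' x hpr k hk1]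
      by_cases hk : k = m+1
      · subst hk
        refine P.around hE hm hk2 {w | h w < h v} x ?_ D ?_ ?_ (Dv x) ih
        · intro w hw1 hw2 hw3 hw4
          rw [lowF x hx] at hw1
          rw [hxv] at hw4
          have a1 := atom _ (swne x hx m le_rfl)
          have a2 := atom _ (swne _ (swne x hx (m+1) (by omega)) m le_rfl)
          have g1 := P.sw_gt x hm hmn
          have g2 := P.sw_gt (sw (m+1) x) hm hmn
          have s1 := P.sw_gt x (m := m+1) (by omega) hk2
          have := P.max_vertex (e1 := x (m+1)) (e2 := sw (m+1) x (m+1)) (u1 := sw m x m)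
            (u2 := sw m (sw (m+1) x) m) (T := x (m+2)) hs2 hvm.1 hvm.2 (by rw [x.rk, hF]; omega)
            (P.sw_self_ne (m+1) (by omega) hk2 x).symm
            (by rw [← hxv]; exact x.lt (by omega) (by omega))
            (by rw [← hxv]; exact s1.1)
            (x.lt (by omega) (by omega)) s1.2 a1.1 g1.2 a2.1 g2.2 hxl hyl
            (by rw [x.rk, hF]; omega) (by rw [(sw (m+1) x).rk, hF]; omega) hw1 (by rw [hw2, hF]; omega) hw3
          refine lt_of_le_of_ne this ?_
          intro heq
          exact hw4 (hs1.1 _ _ hw1 hvm.1 (by rw [hw2, hF]; omega) hvm.2 heq)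
        · intro c hc hcS
          exact (hD c (fun i hi => by rw [hc i hi, hx i hi]) hcS).1
        · intro c hc hcS
          exact (hD c (fun i hi => by rw [hc i hi, hx i hi]) hcS).2
      · rw [P.sw_comm m k (by omega), P.sw_comm m k (by omega),
          (hD _ (swne x hx m le_rfl) hxl).1 k (by omega), ih]
  refine ⟨fun c => if c m = v then Dv c else D c, ?_, ?_⟩
  · intro c hc hcS
    have cl : ∀ c : Fl ρ n, (∀ i < m, c i = a0 i) → h (c m) ≤ h v → c m ≠ v → h (c m) < h v := by
      intro c hc h1 h2
      refine lt_of_le_of_ne h1 ?_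
      intro heq
      exact h2 (hs1.1 _ _ (atom c hc).1 hvm.1 (atom c hc).2 hvm.2 heq)
    by_cases hcv : c m = v
    · refine ⟨fun k hk => ?_, fun hS => ?_⟩
      · simp only [sw_of_ne k c m (by omega), hcv, if_true]
        exact hDv' c (agr c hc hcv) k (by omega)
      · have hne : sw m c m ≠ v := by rw [← hcv]; exact P.sw_self_ne m hm hmn c
        simp only [hcv, hne, if_true, if_false]
        exact KEY c hc hcv (cl _ (swne c hc m le_rfl) hS hne)
    · have hl := cl c hc hcS hcv
      refine ⟨fun k hk => ?_, fun hS => ?_⟩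
      · simp only [sw_of_ne k c m (by omega), hcv, if_false]
        exact (hD c hc hl).1 k hk
      · by_cases hcv' : sw m c m = v
        · simp only [hcv, hcv', if_true, if_false]
          have := KEY (sw m c) (swne c hc m le_rfl) hcv' (by rw [P.sw_sw]; exact hl)
          rw [P.sw_sw] at this
          rw [this, P.sw_sw]
        · simp only [hcv, hcv', if_false]
          exact (hD c hc hl).2 (cl _ (swne c hc m le_rfl) hS hcv')
  · intro c hc
    have : c m ≠ v := fun h => by rw [h] at hc; exact lt_irrefl _ hc
    simp [this]

theorem dev_step (hE : Equi ρ n) {m : ℕ} (hm : 1 ≤ m) (hmn : m < n) (IH : P.Dev (m+1)) : P.Dev m := by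
  intro a b
  have := P.fin
  have hF : ρ (a (m-1)) = m - 1 := by rw [a.rk]; omega
  obtain ⟨h, hs1, hs2, hsv⟩ := P.sweep (a (m-1))
  have fin : ({x | a (m-1) < x ∧ ρ x = m} : Set α).Finite := Set.toFinite _
  obtain ⟨w, ⟨hw1, hw2⟩, hw3⟩ := Set.exists_min_image {x | a (m-1) < x ∧ ρ x = m} h fin
    ⟨a m, a.lt (by omega) (by omega), by rw [a.rk]; omega⟩
  have thr : ∀ v, a (m-1) < v → ρ v = m → ∃ c : Fl ρ n, (∀ i < m, c i = a i) ∧ c m = v := by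
    intro v h1 h2
    obtain ⟨c, hc1, hc2, hc3⟩ := P.ext_through a (m-1) n (by omega) le_rfl v h1.le (P.le_top a v le_rfl)
    exact ⟨c, fun i hi => hc1 i (by omega), by rw [h2] at hc3; exact hc3⟩
  obtain ⟨Φ1, hΦ, hΦw⟩ := thr w hw1 hw2
  -- main construction
  have main : ∀ Ψ1 : Fl ρ n, ∀ v, a (m-1) < v → ρ v = m → ∃ D, PE m a {u | h u ≤ h v} D ∧ D Φ1 = Ψ1 := by
    intro Ψ1
    have wf : WellFounded (fun x y : α => h x < h y) :=
      @Finite.wellFounded_of_trans_of_irrefl α _ (fun x y : α => h x < h y)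
        ⟨fun _ _ _ h1 h2 => h1.trans h2⟩ ⟨fun _ => lt_irrefl _⟩
    intro v
    induction v using wf.induction with
    | _ v ihv =>
    intro hv1 hv2
    have atom : ∀ c : Fl ρ n, (∀ i < m, c i = a i) → a (m-1) < c m ∧ ρ (c m) = m := by
      intro c hc
      rw [← hc (m-1) (by omega), c.rk]
      exact ⟨c.lt (by omega) (by omega), by omega⟩
    by_cases hvw : v = w
    · subst hvw
      obtain ⟨D, hD1, hD2⟩ := IH Φ1 Ψ1
      refine ⟨D, ?_, hD1⟩
      intro c hc hcS
      have only : ∀ c : Fl ρ n, (∀ i < m, c i = a i) → h (c m) ≤ h v → c m = v := by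
        intro c hc hcS
        have h1 := atom c hc
        exact hs1.1 _ _ h1.1 hv1 (by rw [h1.2, hF]; omega) (by rw [hv2, hF]; omega)
          (le_antisymm hcS (hw3 _ h1))
      have hcv := only c hc hcS
      refine ⟨fun k hk => hD2 c ?_ k hk, fun hS => ?_⟩
      · intro i hi
        by_cases him : i = m
        · rw [him, hcv, hΦw]
        · rw [hc i (by omega), hΦ i (by omega)]
      · have := only (sw m c) (fun i hi => by rw [sw_of_ne _ _ _ (by omega)]; exact hc i hi) hS
        exact absurd (this.trans hcv.symm) (P.sw_self_ne m hm hmn c)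
    · have hlt : h w < h v := by
        refine lt_of_le_of_ne (hw3 v ⟨hv1, hv2⟩) fun heq => hvw ?_
        exact (hs1.1 _ _ hw1 hv1 (by rw [hw2, hF]; omega) (by rw [hv2, hF]; omega) heq).symm
      obtain ⟨p, ⟨hp1, hp2, hp3⟩, hp4⟩ := Set.exists_max_image {x | a (m-1) < x ∧ ρ x = m ∧ h x < h v} h
        (Set.toFinite _) ⟨w, hw1, hw2, hlt⟩
      obtain ⟨D, hD1, hD2⟩ := ihv p hp3 hp1 hp2
      obtain ⟨t, ht, htop⟩ := P.top
      obtain ⟨e, u, k1, k2, k3, k4, k5, k6, k7⟩ := hs1.2 t v w hv1 (by rw [hv2, hF]; omega) (htop v) hw1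
        (by rw [hw2, hF]; omega) (htop w) hlt
      obtain ⟨c0, hc0, hc0v⟩ := thr v hv1 hv2
      obtain ⟨Ω0, o1, o2, o3⟩ := P.ext_through c0 m n (by omega) le_rfl e (by rw [hc0v]; exact k1.le)
        (P.le_top _ _ le_rfl)
      rw [k4, hF, show m - 1 + 2 = m+1 by omega] at o3
      have hΩ : ∀ i < m, Ω0 i = a i := fun i hi => by rw [o1 i hi.le, hc0 i hi]
      have hΩv : Ω0 m = v := by rw [o1 m le_rfl, hc0v]
      have hΩu : sw m Ω0 m = u := by
        have := P.dia (a := Ω0) hm hmn (z := u) (by rw [hΩ _ (by omega)]; exact k5) (by rw [o3]; exact k2)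
        rcases this with h1 | h1
        · rw [h1, hΩv] at k7; exact absurd k7 (lt_irrefl _)
        · exact h1.symm
      obtain ⟨h', hh1, hh2⟩ := hsv v hv1 (by rw [hv2, hF]; omega)
      obtain ⟨D', hD', hD''⟩ := P.ext_step hE hm hmn IH a h h' v hs1 hs2 hh1 hh2 Ω0 hΩ hΩv
        (by rw [hΩu]; exact k7) D (by
          have lw : ∀ c : Fl ρ n, (∀ i < m, c i = a i) → h (c m) < h v → h (c m) ≤ h p := by
            intro c hc hl
            have := atom c hc
            exact hp4 _ ⟨this.1, this.2, hl⟩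
          intro c hc hcS
          have := hD1 c hc (lw c hc hcS)
          exact ⟨this.1, fun hS => this.2 (lw (sw m c) (fun i hi => by rw [sw_of_ne _ _ _ (by omega)]; exact hc i hi) hS)⟩)
      exact ⟨D', hD', by rw [hD'' _ (by rw [hΦw]; exact hlt), hD2]⟩
  obtain ⟨M, ⟨hM1, hM2⟩, hM3⟩ := Set.exists_max_image {x | a (m-1) < x ∧ ρ x = m} h fin
    ⟨a m, a.lt (by omega) (by omega), by rw [a.rk]; omega⟩
  have all : ∀ Ψ1 : Fl ρ n, ∃ D : Fl ρ n → Fl ρ n, D Φ1 = Ψ1 ∧ ∀ c : Fl ρ n, (∀ i < m, c i = a i) → ∀ k, m ≤ k →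
      D (sw k c) = sw k (D c) := by
    intro Ψ1
    obtain ⟨D, hD1, hD2⟩ := main Ψ1 M hM1 hM2
    refine ⟨D, hD2, ?_⟩
    intro c hc k hk
    have mem : ∀ c : Fl ρ n, (∀ i < m, c i = a i) → h (c m) ≤ h M := by
      intro c hc
      apply hM3
      refine ⟨?_, by rw [c.rk]; omega⟩
      rw [← hc (m-1) (by omega)]
      exact c.lt (by omega) (by omega)
    have := hD1 c hc (mem c hc)
    rcases Nat.eq_or_lt_of_le hk with rfl | hk
    · exact this.2 (mem (sw m c) (fun i hi => by rw [sw_of_ne _ _ _ (by omega)]; exact hc i hi))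
    · exact this.1 k hk
  -- normalisation
  have path := P.conn_top m a Φ1 (fun i hi => (hΦ i hi).symm)
  have norm : ∀ c, Rch (fun _ => True) m n a c → ∃ Ψ : Fl ρ n, ∀ D : Fl ρ n → Fl ρ n,
      (∀ c : Fl ρ n, (∀ i < m, c i = a i) → ∀ k, m ≤ k → D (sw k c) = sw k (D c)) → D c = Ψ → D a = b := by
    intro c hc
    induction hc with
    | refl => exact ⟨b, fun D _ h => h⟩
    | @tail x y p1 p2 ih =>
      obtain ⟨Ψ, hΨ⟩ := ih
      obtain ⟨_, _, k, hk1, hk2, rfl⟩ := p2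
      refine ⟨sw k Ψ, fun D hD hDy => hΨ D hD ?_⟩
      rw [hD x (fun i hi => Rch.pres p1 i (Or.inl hi)) k hk1] at hDy
      have := congrArg (sw k) hDy
      rwa [P.sw_sw, P.sw_sw] at this
  obtain ⟨Ψ, hΨ⟩ := norm _ path
  obtain ⟨D, hD1, hD2⟩ := all Ψ
  exact ⟨D, hΨ D hD2 hD1, hD2⟩

theorem dev (hE : Equi ρ n) (m : ℕ) (hm : 1 ≤ m) : P.Dev m := by
  have key : ∀ j m, 1 ≤ m → n ≤ m + j → P.Dev m := by
    intro j
    induction j with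
    | zero =>
      intro m hm hn a b
      refine ⟨fun _ => b, rfl, fun c _ k hk => ?_⟩
      exact (P.sw_triv k (by omega) b).symm
    | succ j ih =>
      intro m hm hn
      rcases Nat.lt_or_ge m n with h | h
      · exact P.dev_step hE hm h (ih (m+1) (by omega) (by omega))
      · exact ih m hm (by omega)
  exact key n m hm (by omega)

/-- Under `Equi` all flags are equivalent. -/
theorem trans_of_equi (hE : Equi ρ n) (a b : Fl ρ n) : ∃ γ : α ≃o α, ∀ i, γ (a i) = b i := by
  obtain ⟨D, hD, hD1⟩ := P.dev hE 1 le_rfl a b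
  obtain ⟨D', hD', hD1'⟩ := P.dev hE 1 le_rfl b a
  have full : ∀ (D : Fl ρ n → Fl ρ n) (a : Fl ρ n), (∀ c : Fl ρ n, (∀ i < 1, c i = a i) → ∀ k, 1 ≤ k →
      D (sw k c) = sw k (D c)) → ∀ c k, D (sw k c) = sw k (D c) := by
    intro D a h c k
    rcases Nat.eq_zero_or_pos k with rfl | hk
    · rw [P.sw_triv 0 (by omega), P.sw_triv 0 (by omega)]
    · exact h c (fun i hi => by rw [show i = 0 by omega]; exact P.fl_zero _ _) k hk
  obtain ⟨γ, hγ⟩ := P.exists_aut D D' (full D a hD1) (full D' b hD1') a (by rw [hD, hD'])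
    (by rw [hD, hD', hD])
  exact ⟨γ, fun i => by rw [hγ, hD]⟩

end PP


/-- Two flags are equivalent under an automorphism. -/
def Eqv (a b : Fl ρ n) : Prop := ∃ γ : α ≃o α, ∀ i, γ (a i) = b i

theorem Eqv.refl (a : Fl ρ n) : Eqv a a := ⟨OrderIso.refl α, fun _ => rfl⟩
theorem Eqv.symm {a b : Fl ρ n} (h : Eqv a b) : Eqv b a := by
  obtain ⟨γ, h⟩ := h
  exact ⟨γ.symm, fun i => by rw [← h i, γ.symm_apply_apply]⟩
theorem Eqv.trans {a b c : Fl ρ n} (h : Eqv a b) (h' : Eqv b c) : Eqv a c := by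
  obtain ⟨γ, h⟩ := h
  obtain ⟨γ', h'⟩ := h'
  exact ⟨γ.trans γ', fun i => by rw [← h' i, ← h i]; rfl⟩

namespace PP
variable (P : PP ρ n)
include P

theorem aut_rank (γ : α ≃o α) (x : α) : ρ (γ x) = ρ x := by
  obtain ⟨a, ha, -⟩ := P.exists_fl_through (le_refl x)
  have h1 : ∀ k, k ≤ n → k ≤ ρ (γ (a k)) := by
    intro k
    induction k with
    | zero => intro _; omega
    | succ k ih =>
      intro hk
      have := P.smono (γ.strictMono (a.lt (show k < k+1 by omega) (by omega)))
      have := ih (by omega)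
      omega
  have h2 : ∀ j k, k + j = n → ρ (γ (a k)) ≤ k := by
    intro j
    induction j with
    | zero => intro k hk; have := P.rk_le (γ (a k)); omega
    | succ j ih =>
      intro k hk
      have := P.smono (γ.strictMono (a.lt (show k < k+1 by omega) (by omega)))
      have := ih (k+1) (by omega)
      omega
  have hx := P.rk_le x
  have e1 := h1 (ρ x) hx
  have e2 := h2 (n - ρ x) (ρ x) (by omega)
  rw [ha] at e1 e2
  omega

theorem exists_map (γ : α ≃o α) : ∃ M : Fl ρ n → Fl ρ n, (∀ a i, M a i = γ (a i)) ∧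
    ∀ k a, M (sw k a) = sw k (M a) := by
  refine ⟨fun a => ⟨fun i => γ (a i), fun i j h => γ.monotone (a.mono h), fun k => by
    rw [P.aut_rank, a.rk]⟩, fun _ _ => rfl, ?_⟩
  intro k a
  by_cases hk : 1 ≤ k ∧ k < n
  · have := P.eq_or_sw (a := (⟨fun i => γ (a i), fun i j h => γ.monotone (a.mono h), fun k => by
      rw [P.aut_rank, a.rk]⟩ : Fl ρ n)) (b := ⟨fun i => γ (sw k a i), fun i j h => γ.monotone ((sw k a).mono h), fun k' => by
      rw [P.aut_rank, (sw k a).rk]⟩) k (fun i hi => by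
        show γ (sw k a i) = γ (a i)
        rw [sw_of_ne _ _ _ hi])
    rcases this with h | h
    · exfalso
      apply P.sw_self_ne k hk.1 hk.2 a
      have := congrArg (fun x : Fl ρ n => x k) h
      exact γ.injective this
    · exact h
  · rw [P.sw_triv k hk, P.sw_triv k hk]

theorem equi_of (k : ℕ) (two : ∀ A B C : Fl ρ n, ¬ Eqv A B → ¬ Eqv B C → Eqv A C)
    (h1 : ∀ Ω : Fl ρ n, ¬ Eqv Ω (sw k Ω)) (h2 : ∀ Ω : Fl ρ n, ¬ Eqv Ω (sw (k+1) Ω)) : Equi ρ n := by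
  intro i q a b hq
  have hl : ∃ l, l + 1 ≠ i ∧ l ≠ i + 2 ∧ ∀ Ω : Fl ρ n, ¬ Eqv Ω (sw l Ω) := by
    by_cases hk : k + 1 ≠ i ∧ k ≠ i + 2
    · exact ⟨k, hk.1, hk.2, h1⟩
    · exact ⟨k+1, by omega, by omega, h2⟩
  obtain ⟨l, l1, l2, hl⟩ := hl
  have inv : ∀ a b : Fl ρ n, Eqv a b → (rot i)^[q] a = a → (rot i)^[q] b = b := by
    rintro a b ⟨γ, hγ⟩ h
    obtain ⟨M, hM, hM'⟩ := P.exists_map γ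
    have hb : b = M a := Fl.ext' fun i => by rw [hM, hγ]
    have : ∀ q, (rot i)^[q] (M a) = M ((rot i)^[q] a) := by
      intro q
      induction q with
      | zero => rfl
      | succ q ih => rw [Function.iterate_succ_apply', Function.iterate_succ_apply', ih]; unfold rot; rw [hM', hM']
    rw [hb, this, h]
  have conj : ∀ s : Fl ρ n → Fl ρ n, (∀ c, rot i (s (rot i c)) = s c) → (rot i)^[q] (s a) = s a := by
    intro s hs
    have : ∀ q c, (rot i)^[q] (s ((rot i)^[q] c)) = s c := by
      intro q
      induction q with
      | zero => intro c; rfl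
      | succ q ih =>
        intro c
        rw [Function.iterate_succ_apply' (rot i) q c, Function.iterate_succ_apply, hs, ih]
    have := this q a
    rwa [hq] at this
  have hsl : (rot i)^[q] (sw l a) = sw l a := by
    by_cases e1 : l = i
    · subst e1
      apply conj
      intro c; unfold rot
      simp only [P.sw_sw]
    by_cases e2 : l = i + 1
    · subst e2
      apply conj
      intro c; unfold rot
      simp only [P.sw_sw]
    have cm : ∀ c : Fl ρ n, rot i (sw l c) = sw l (rot i c) := by
      intro c
      unfold rot
      rcases Nat.lt_or_ge l i with h | h
      · rw [← P.sw_comm l i (by omega), ← P.sw_comm l (i+1) (by omega)]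
      · rw [P.sw_comm i l (by omega), P.sw_comm (i+1) l (by omega)]
    have : ∀ q, (rot i)^[q] (sw l a) = sw l ((rot i)^[q] a) := by
      intro q
      induction q with
      | zero => rfl
      | succ q ih => rw [Function.iterate_succ_apply', Function.iterate_succ_apply', ih, cm]
    rw [this, hq]
  by_cases hab : Eqv b a
  · exact inv a b hab.symm hq
  · exact inv _ _ (two b a (sw l a) hab (hl a)).symm hsl

theorem not_two_consec (k : ℕ) (two : ∀ A B C : Fl ρ n, ¬ Eqv A B → ¬ Eqv B C → Eqv A C)
    (h1 : ∀ Ω : Fl ρ n, ¬ Eqv Ω (sw k Ω)) (h2 : ∀ Ω : Fl ρ n, ¬ Eqv Ω (sw (k+1) Ω)) (a : Fl ρ n) : False :=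
  h1 a (P.trans_of_equi (P.equi_of k two h1 h2) a (sw k a))

/-- four distinct elements -/
theorem four (J a' : ℕ) (h1 : 1 ≤ J) (h2 : J < n) (ha1 : 1 ≤ a') (ha2 : a' < n)
    (haJ : a' = J + 1 ∨ a' + 1 = J)
    (two : ∀ A B C : Fl ρ n, ¬ Eqv A B → ¬ Eqv B C → Eqv A C)
    (hr : ∀ Ω : Fl ρ n, ¬ Eqv Ω (sw J Ω)) (ht : ∀ Ω : Fl ρ n, Eqv Ω (sw a' Ω))
    (Ω : Fl ρ n) :
    ∃ s : Finset α, s.card = 4 ∧ ∀ x ∈ s, ∃ X : Fl ρ n, X J = x ∧ ∀ i, i ≠ J → i ≠ a' → X i = Ω i := by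
  have key : ∀ X Y : Fl ρ n, (∀ i, i ≠ J → i ≠ a' → X i = Y i) → X J = Y J → X = Y ∨ X = sw a' Y := by
    intro X Y h h'
    apply P.eq_or_sw
    intro i hi
    by_cases hiJ : i = J
    · rw [hiJ, h']
    · exact h i hiJ hi
  have keyE : ∀ X Y : Fl ρ n, (∀ i, i ≠ J → i ≠ a' → X i = Y i) → X J = Y J → Eqv X Y := by
    intro X Y h h'
    rcases key X Y h h' with rfl | rfl
    · exact Eqv.refl _
    · exact (ht Y).symm
  have sq : ∀ Ω : Fl ρ n, sw J Ω J ≠ sw J (sw a' Ω) J := by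
    intro Ω h
    have n1 := P.sw_self_ne J h1 h2 Ω
    have n2 := P.sw_self_ne a' ha1 ha2 Ω
    rcases haJ with haJ | haJ
    · subst haJ
      have g1 := P.sw_gt Ω h1 h2
      have g2 := P.sw_gt (sw (J+1) Ω) h1 h2
      refine n2 (P.lin (Ω J) (sw J Ω J) (sw (J+1) Ω (J+1)) (Ω (J+1)) n1.symm ?_ ?_ ?_ ?_ ?_ ?_ ?_)
      · rw [← sw_of_ne (J+1) Ω J (by omega)]; exact Fl.lt _ (by omega) (by omega)
      · exact Fl.lt _ (by omega) (by omega)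
      · rw [h]; exact g2.2
      · exact g1.2
      · rw [(sw J Ω).rk, Ω.rk]
      · rw [(sw (J+1) Ω).rk, Ω.rk]; omega
      · rw [Ω.rk, Ω.rk]; omega
    · subst haJ
      have g1 := P.sw_gt Ω h1 h2
      have g2 := P.sw_gt (sw a' Ω) h1 h2
      rw [Nat.add_sub_cancel] at g1 g2
      refine n1 (P.lin (Ω a') (sw a' Ω a') (sw (a'+1) Ω (a'+1)) (Ω (a'+1)) n2.symm ?_ ?_ ?_ ?_ ?_ ?_ ?_)
      · exact g1.1
      · exact Fl.lt _ (by omega) (by omega)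
      · rw [h]; exact g2.1
      · exact (P.sw_gt Ω ha1 ha2).2
      · rw [(sw a' Ω).rk, Ω.rk]
      · rw [(sw (a'+1) Ω).rk, Ω.rk]; omega
      · rw [Ω.rk, Ω.rk]; omega
  have o : ∀ X : Fl ρ n, (∀ i, i ≠ J → i ≠ a' → X i = Ω i) → ∀ k, (k = J ∨ k = a') →
      (∀ i, i ≠ J → i ≠ a' → sw k X i = Ω i) := by
    intro X hX k hk i h1 h2
    rw [sw_of_ne _ _ _ (by rcases hk with rfl | rfl <;> assumption), hX i h1 h2]
  have o1 := o Ω (fun _ _ _ => rfl) J (Or.inl rfl)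
  have o2 := o _ (o Ω (fun _ _ _ => rfl) a' (Or.inr rfl)) J (Or.inl rfl)
  have o3 := o _ (o _ o1 a' (Or.inr rfl)) J (Or.inl rfl)
  have d1 : Ω J ≠ sw J Ω J := (P.sw_self_ne J h1 h2 Ω).symm
  have d2 : Ω J ≠ sw J (sw a' Ω) J := fun h =>
    hr _ ((ht Ω).symm.trans (keyE Ω _ (fun i h1 h2 => (o2 i h1 h2).symm) h))
  have d3 : Ω J ≠ sw J (sw a' (sw J Ω)) J := by
    have := sq (sw J Ω)
    rwa [P.sw_sw] at this
  have d4 := sq Ω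
  have d5 : sw J Ω J ≠ sw J (sw a' (sw J Ω)) J := fun h =>
    hr _ ((ht (sw J Ω)).symm.trans (keyE _ _ (fun i h1 h2 => by rw [o1 i h1 h2, o3 i h1 h2]) h))
  have d6 : sw J (sw a' Ω) J ≠ sw J (sw a' (sw J Ω)) J := by
    intro h
    have e1 := keyE _ _ (fun i h1 h2 => by rw [o2 i h1 h2, o3 i h1 h2]) h
    have e2 : Eqv (sw J (sw a' (sw J Ω))) Ω := by
      refine two _ (sw J Ω) _ (fun h => ?_) (fun h => hr Ω h.symm)
      exact hr _ ((ht (sw J Ω)).symm.trans h.symm)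
    exact hr _ ((ht Ω).symm.trans (e1.trans e2).symm)
  refine ⟨{Ω J, sw J Ω J, sw J (sw a' Ω) J, sw J (sw a' (sw J Ω)) J}, ?_, ?_⟩
  · rw [Finset.card_insert_of_notMem, Finset.card_insert_of_notMem, Finset.card_pair d6]
    · simp [d4, d5]
    · simp [d1, d2, d3]
  · intro x hx
    simp only [Finset.mem_insert, Finset.mem_singleton] at hx
    rcases hx with rfl | rfl | rfl | rfl
    · exact ⟨Ω, rfl, fun _ _ _ => rfl⟩
    · exact ⟨_, rfl, o1⟩
    · exact ⟨_, rfl, o2⟩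
    · exact ⟨_, rfl, o3⟩

end PP


namespace PP
variable (P : PP ρ n)
include P

theorem dia_le {F G : α} (hFG : F < G) (hr : ρ G = ρ F + 2) (s : Finset α)
    (hs : ∀ z ∈ s, F < z ∧ z < G) : s.card ≤ 2 := by
  obtain ⟨x, y, hxy, hd⟩ := P.diamond F G hFG hr
  have : s ⊆ {x, y} := by
    intro z hz
    have := (hd z).1 (hs z hz)
    simpa using this
  calc s.card ≤ ({x, y} : Finset α).card := Finset.card_le_card this
    _ ≤ 2 := Finset.card_le_two

/-- Euler-type inequality: a rank 3 section has fewer edges than vertices and faces together. -/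
theorem euler [Fintype α] {F G : α} (hFG : F < G) (hr : ρ G = ρ F + 4) :
    (Finset.univ.filter fun e => F < e ∧ e < G ∧ ρ e = ρ F + 2).card <
    (Finset.univ.filter fun e => F < e ∧ e < G ∧ ρ e = ρ F + 1).card +
    (Finset.univ.filter fun e => F < e ∧ e < G ∧ ρ e = ρ F + 3).card := by
  obtain ⟨h, hs1, hs2, hsv⟩ := P.sweep F
  choose! h' hh1 hh2 using hsv
  set E := Finset.univ.filter fun e => F < e ∧ e < G ∧ ρ e = ρ F + 2 with hE
  set V := Finset.univ.filter fun e => F < e ∧ e < G ∧ ρ e = ρ F + 1 with hV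
  set C := Finset.univ.filter fun e => F < e ∧ e < G ∧ ρ e = ρ F + 3 with hC
  have memE : ∀ x, x ∈ E ↔ F < x ∧ x < G ∧ ρ x = ρ F + 2 := by simp [hE]
  have memV : ∀ x, x ∈ V ↔ F < x ∧ x < G ∧ ρ x = ρ F + 1 := by simp [hV]
  have memC : ∀ x, x ∈ C ↔ F < x ∧ x < G ∧ ρ x = ρ F + 3 := by simp [hC]
  have hVne : V.Nonempty := by
    obtain ⟨a, ha, ha'⟩ := P.exists_fl_through hFG.le
    have hG := P.rk_le G
    refine ⟨a (ρ F + 1), (memV _).2 ⟨?_, ?_, ?_⟩⟩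
    · exact ha.symm.trans_lt (a.lt (by omega) (by omega))
    · exact (a.lt (by omega) (by omega)).trans_eq ha'
    · rw [a.rk]; omega
  obtain ⟨w, hwV, hw⟩ := Finset.exists_min_image V h hVne
  -- top vertex of an edge
  have top : ∀ e ∈ E, ∃ v u, v ∈ V ∧ u ∈ V ∧ v < e ∧ u < e ∧ h u < h v := by
    intro e he
    obtain ⟨e1, e2, e3⟩ := (memE e).1 he
    obtain ⟨x, y, hxy, hd⟩ := P.diamond F e e1 e3
    have hx := (hd x).2 (Or.inl rfl)
    have hy := (hd y).2 (Or.inr rfl)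
    have rx : ρ x = ρ F + 1 := by
      have := P.smono hx.1; have := P.smono hx.2; omega
    have ry : ρ y = ρ F + 1 := by
      have := P.smono hy.1; have := P.smono hy.2; omega
    have vx : x ∈ V := (memV x).2 ⟨hx.1, hx.2.trans e2, rx⟩
    have vy : y ∈ V := (memV y).2 ⟨hy.1, hy.2.trans e2, ry⟩
    rcases lt_trichotomy (h x) (h y) with hl | hl | hl
    · exact ⟨y, x, vy, vx, hy.2, hx.2, hl⟩
    · exact absurd (hs1.1 x y hx.1 hy.1 rx ry hl) hxy
    · exact ⟨x, y, vx, vy, hx.2, hy.2, hl⟩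
  have ex : ∀ e ∈ E, ∃ x v u, (v ∈ V ∧ u ∈ V ∧ v < e ∧ u < e ∧ h u < h v) ∧
      ((x = v ∧ ∀ e' ∈ E, v < e' → h' v e ≤ h' v e') ∨
       (x ∈ C ∧ e < x ∧ ∃ e' ∈ E, v < e' ∧ e' < x ∧ h' v e' < h' v e)) := by
    intro e he
    obtain ⟨v, u, t1, t2, t3, t4, t5⟩ := top e he
    by_cases hmin : ∀ e' ∈ E, v < e' → h' v e ≤ h' v e'
    · exact ⟨v, v, u, ⟨t1, t2, t3, t4, t5⟩, Or.inl ⟨rfl, hmin⟩⟩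
    · push Not at hmin
      obtain ⟨e', he', hve', hlt⟩ := hmin
      obtain ⟨v1, v2, v3⟩ := (memV v).1 t1
      obtain ⟨e1, e2, e3⟩ := (memE e).1 he
      obtain ⟨e1', e2', e3'⟩ := (memE e').1 he'
      obtain ⟨T, e'', k1, k2, k3, k4, k5, k6, k7⟩ := (hh1 v v1 v3).2 G e e' t3 (by omega) e2.le hve' (by omega)
        e2'.le hlt
      have hTG : T < G := P.lt_of_le k3 (by omega)
      refine ⟨T, v, u, ⟨t1, t2, t3, t4, t5⟩, Or.inr ⟨(memC T).2 ⟨e1.trans k1, hTG, by omega⟩, k1, e'',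
        (memE _).2 ⟨v1.trans k5, k2.trans hTG, by omega⟩, k5, k2, k7⟩⟩
  choose! φ v u hφ1 hφ2 using ex
  have maps : ∀ e ∈ E, φ e ∈ V.erase w ∪ C := by
    intro e he
    rcases hφ2 e he with ⟨h1, -⟩ | ⟨h1, -⟩
    · obtain ⟨t1, t2, t3, t4, t5⟩ := hφ1 e he
      rw [Finset.mem_union]; left
      rw [h1, Finset.mem_erase]
      refine ⟨?_, t1⟩
      intro hvw
      have := hw _ t2
      rw [hvw] at t5
      linarith
    · exact Finset.mem_union_right _ h1
  have neg : ∀ e ∈ E, ∀ v ∈ V, v < e → ∀ u ∈ V, u < e → u ≠ v → (h u < h v ↔ h' v e < 0) := by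
    intro e he v hv hve u hu hue hne
    obtain ⟨v1, v2, v3⟩ := (memV v).1 hv
    obtain ⟨u1, u2, u3⟩ := (memV u).1 hu
    obtain ⟨e1, e2, e3⟩ := (memE e).1 he
    exact hh2 v v1 v3 e u hve e3 u1 u3 hue hne
  have mx : ∀ e ∈ E, φ e ∈ C → ∀ x ∈ V, x < φ e → h x ≤ h (v e) := by
    intro e he hC' x hx hxT
    obtain ⟨t1, t2, t3, t4, t5⟩ := hφ1 e he
    rcases hφ2 e he with ⟨h1, -⟩ | ⟨-, h1, e', he', h2, h3, h4⟩
    · rw [h1] at hC'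
      have := ((memC _).1 hC').2.2
      have := ((memV _).1 t1).2.2
      omega
    have hne : u e ≠ v e := fun hh => by rw [hh] at t5; exact lt_irrefl _ t5
    have n1 := (neg e he _ t1 t3 _ t2 t4 hne).1 t5
    have n2 : h' (v e) e' < 0 := h4.trans n1
    -- the other vertex of e'
    obtain ⟨p, q, p1, p2, p3, p4, p5⟩ := top e' he'
    have : ∃ u', u' ∈ V ∧ u' < e' ∧ u' ≠ v e := by
      by_cases hp : p = v e
      · exact ⟨q, p2, p4, fun hq => by rw [hp, hq] at p5; exact lt_irrefl _ p5⟩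
      · exact ⟨p, p1, p3, hp⟩
    obtain ⟨u', q1, q2, q3⟩ := this
    have n3 := (neg e' he' _ t1 h2 u' q1 q2 q3).2 n2
    obtain ⟨v1, v2, v3⟩ := (memV _).1 t1
    refine P.max_vertex (T := φ e) hs2 v1 v3 ((memC _).1 hC').2.2 (e1 := e) (e2 := e') ?_ t3 h2 h1 h3
      ((memV _).1 t2).1 t4 ((memV _).1 q1).1 q2 t5 n3 ((memE _).1 he).2.2 ((memE _).1 he').2.2
      ((memV _).1 hx).1 ((memV _).1 hx).2.2 hxT.le
    rintro rfl
    exact lt_irrefl _ h4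
  have inj : Set.InjOn φ E := by
    intro e1 he1 e2 he2 heq
    have he1 : e1 ∈ E := he1
    have he2 : e2 ∈ E := he2
    obtain ⟨t1, t2, t3, t4, t5⟩ := hφ1 e1 he1
    obtain ⟨s1, s2, s3, s4, s5⟩ := hφ1 e2 he2
    obtain ⟨v1, v2, v3⟩ := (memV _).1 t1
    obtain ⟨w1, w2, w3⟩ := (memV _).1 s1
    have r1 := ((memE _).1 he1).2.2
    have r2 := ((memE _).1 he2).2.2
    rcases hφ2 e1 he1 with ⟨a1, a2⟩ | ⟨a1, a2, e', he', a3, a4, a5⟩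
    · rcases hφ2 e2 he2 with ⟨b1, b2⟩ | ⟨b1, -⟩
      · have hv : v e1 = v e2 := by rw [← a1, ← b1, heq]
        rw [← hv] at b2 s3
        exact (hh1 _ v1 v3).1 _ _ t3 s3 (by omega) (by omega)
          (le_antisymm (a2 e2 he2 s3) (b2 e1 he1 t3))
      · rw [← heq, a1] at b1
        have := ((memC _).1 b1).2.2
        omega
    · rcases hφ2 e2 he2 with ⟨b1, -⟩ | ⟨b1, b2, e'', he'', b3, b4, b5⟩
      · rw [heq, b1] at a1
        have := ((memC _).1 a1).2.2
        omega
      · have m1 := mx e1 he1 a1 (v e2) s1 (by rw [heq]; exact s3.trans b2)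
        have m2 := mx e2 he2 b1 (v e1) t1 (by rw [← heq]; exact t3.trans a2)
        have hv : v e1 = v e2 := hs1.1 _ _ v1 w1 v3 w3 (le_antisymm m2 m1)
        rw [← hv] at b3 b5 s3
        rw [← heq] at b2 b4
        obtain ⟨x, y, hxy, hd⟩ := P.diamond (v e1) (φ e1) (t3.trans a2) (by
          rw [((memC _).1 a1).2.2]; omega)
        have d1 := (hd e1).1 ⟨t3, a2⟩
        have d2 := (hd e').1 ⟨a3, a4⟩
        have d3 := (hd e2).1 ⟨s3, b2⟩
        have d4 := (hd e'').1 ⟨b3, b4⟩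
        by_contra hne
        have n1 : e' ≠ e1 := fun hh => by rw [hh] at a5; exact lt_irrefl _ a5
        have n2 : e'' ≠ e2 := fun hh => by rw [hh] at b5; exact lt_irrefl _ b5
        have f1 : e' = e2 := by grind
        have f2 : e'' = e1 := by grind
        rw [f1] at a5
        rw [f2] at b5
        exact lt_asymm a5 b5
  have c1 := Finset.card_le_card_of_injOn φ maps inj
  have c2 := Finset.card_union_le (V.erase w) C
  have c3 := Finset.card_erase_of_mem hwV
  have c4 := Finset.card_pos.2 hVne
  omega

theorem even_case (J : ℕ) (hJ : 2 ≤ J) (hJn : J + 2 ≤ n)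
    (two : ∀ A B C : Fl ρ n, ¬ Eqv A B → ¬ Eqv B C → Eqv A C)
    (hr : ∀ Ω : Fl ρ n, ¬ Eqv Ω (sw J Ω)) (ht : ∀ Ω : Fl ρ n, Eqv Ω (sw (J-1) Ω))
    (ht' : ∀ Ω : Fl ρ n, Eqv Ω (sw (J+1) Ω)) (a : Fl ρ n) : False := by
  have := P.fin
  have := Fintype.ofFinite α
  have rF : ρ (a (J-2)) = J - 2 := by rw [a.rk]; omega
  have rG : ρ (a (J+2)) = J + 2 := by rw [a.rk]; omega
  have hE := P.euler (F := a (J-2)) (G := a (J+2)) (a.lt (by omega) (by omega)) (by omega)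
  rw [rF, show J - 2 + 2 = J by omega, show J - 2 + 1 = J - 1 by omega, show J - 2 + 3 = J + 1 by omega] at hE
  have c1 := Finset.card_mul_le_card_mul (fun x e : α => x < e)
    (s := Finset.univ.filter fun e => a (J-2) < e ∧ e < a (J+2) ∧ ρ e = J - 1)
    (t := Finset.univ.filter fun e => a (J-2) < e ∧ e < a (J+2) ∧ ρ e = J) (m := 4) (n := 2) (by
      intro v hv
      simp only [Finset.mem_filter, Finset.mem_univ, true_and] at hv
      obtain ⟨Ω, o1, o2, o3⟩ := P.ext_through a (J-2) (J+2) (by omega) (by omega) v hv.1.le hv.2.1.le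
      rw [hv.2.2] at o3
      obtain ⟨s, hs, hs'⟩ := P.four J (J+1) (by omega) (by omega) (by omega) (by omega) (Or.inl rfl) two hr ht' Ω
      rw [← hs]
      apply Finset.card_le_card
      intro x hx
      obtain ⟨X, rfl, hX⟩ := hs' x hx
      simp only [Finset.mem_bipartiteAbove, Finset.mem_filter, Finset.mem_univ, true_and]
      refine ⟨⟨?_, ?_, ?_⟩, ?_⟩
      · rw [← o1 _ le_rfl, ← hX _ (by omega) (by omega)]; exact X.lt (by omega) (by omega)
      · rw [← o2 _ le_rfl, ← hX _ (by omega) (by omega)]; exact X.lt (by omega) (by omega)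
      · rw [X.rk]; omega
      · rw [← o3, ← hX _ (by omega) (by omega)]; exact X.lt (by omega) (by omega)) (by
      intro e he
      simp only [Finset.mem_filter, Finset.mem_univ, true_and] at he
      apply P.dia_le he.1 (by omega)
      intro z hz
      simp only [Finset.mem_bipartiteBelow, Finset.mem_filter, Finset.mem_univ, true_and] at hz
      exact ⟨hz.1.1, hz.2⟩)
  have c2 := Finset.card_mul_le_card_mul (fun x e : α => e < x)
    (s := Finset.univ.filter fun e => a (J-2) < e ∧ e < a (J+2) ∧ ρ e = J + 1)
    (t := Finset.univ.filter fun e => a (J-2) < e ∧ e < a (J+2) ∧ ρ e = J) (m := 4) (n := 2) (by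
      intro v hv
      simp only [Finset.mem_filter, Finset.mem_univ, true_and] at hv
      obtain ⟨Ω, o1, o2, o3⟩ := P.ext_through a (J-2) (J+2) (by omega) (by omega) v hv.1.le hv.2.1.le
      rw [hv.2.2] at o3
      obtain ⟨s, hs, hs'⟩ := P.four J (J-1) (by omega) (by omega) (by omega) (by omega) (Or.inr (by omega)) two hr ht Ω
      rw [← hs]
      apply Finset.card_le_card
      intro x hx
      obtain ⟨X, rfl, hX⟩ := hs' x hx
      simp only [Finset.mem_bipartiteAbove, Finset.mem_filter, Finset.mem_univ, true_and]
      refine ⟨⟨?_, ?_, ?_⟩, ?_⟩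
      · rw [← o1 _ le_rfl, ← hX _ (by omega) (by omega)]; exact X.lt (by omega) (by omega)
      · rw [← o2 _ le_rfl, ← hX _ (by omega) (by omega)]; exact X.lt (by omega) (by omega)
      · rw [X.rk]; omega
      · rw [← o3, ← hX _ (by omega) (by omega)]; exact X.lt (by omega) (by omega)) (by
      intro e he
      simp only [Finset.mem_filter, Finset.mem_univ, true_and] at he
      apply P.dia_le he.2.1 (by omega)
      intro z hz
      simp only [Finset.mem_bipartiteBelow, Finset.mem_filter, Finset.mem_univ, true_and] at hz
      exact ⟨hz.2, hz.1.2.1⟩)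
  omega

/-- The abstract version of the theorem. -/
theorem abs (K : Set ℕ) (hΦ : ∃ Φ Ψ : Fl ρ n, ¬ Eqv Φ Ψ ∧ ∀ Ω, Eqv Ω Φ ∨ Eqv Ω Ψ)
    (hK : ∀ (Ω : Fl ρ n) k, 1 ≤ k → k < n → (Eqv Ω (sw k Ω) ↔ k ∈ K)) (J : ℕ) (hJ : 2 ≤ J) (hJn : J + 2 ≤ n)
    (hJK : J ∉ K) : False := by
  obtain ⟨Φ, Ψ, hne, hall⟩ := hΦ
  have two : ∀ A B C : Fl ρ n, ¬ Eqv A B → ¬ Eqv B C → Eqv A C := by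
    intro A B C h1 h2
    rcases hall A with a | a <;> rcases hall B with b | b <;> rcases hall C with c | c
    all_goals first
      | exact a.trans c.symm
      | exact absurd (a.trans b.symm) h1
      | exact absurd (b.trans c.symm) h2
  have hr : ∀ Ω : Fl ρ n, ¬ Eqv Ω (sw J Ω) := fun Ω => by
    rw [hK Ω J (by omega) (by omega)]; exact hJK
  by_cases h1 : J - 1 ∈ K
  · by_cases h2 : J + 1 ∈ K
    · exact P.even_case J hJ hJn two hr (fun Ω => (hK Ω _ (by omega) (by omega)).2 h1)
        (fun Ω => (hK Ω _ (by omega) (by omega)).2 h2) Φ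
    · exact P.not_two_consec J two hr (fun Ω => by rw [hK Ω (J+1) (by omega) (by omega)]; exact h2) Φ
  · refine P.not_two_consec (J-1) two (fun Ω => by rw [hK Ω (J-1) (by omega) (by omega)]; exact h1) ?_ Φ
    rw [show J - 1 + 1 = J by omega]; exact hr

end PP


section Geometry
variable {ι V : Type*} [Finite ι] [AddCommGroup V] [Module ℝ V] [FiniteDimensional ℝ V]

/-- A vector configuration realizing the order: `α` is the face lattice of the cone over `x`. -/
structure Cfg (x : ι → V) (supp : α → Set ι) (fn : α → (V →ₗ[ℝ] ℝ)) : Prop where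
  le : ∀ a b, a ≤ b ↔ supp a ⊆ supp b
  nn : ∀ a i, 0 ≤ fn a (x i)
  zero : ∀ a i, i ∈ supp a ↔ fn a (x i) = 0
  all : ∀ f : V →ₗ[ℝ] ℝ, (∀ i, 0 ≤ f (x i)) → ∃ a, ∀ i, i ∈ supp a ↔ f (x i) = 0
  pos : ∃ f : V →ₗ[ℝ] ℝ, ∀ i, 0 < f (x i)

/-- span of a face -/
def spn (x : ι → V) (supp : α → Set ι) (a : α) : Submodule ℝ V := Submodule.span ℝ (x '' supp a)

/-- rank of a face -/
noncomputable def rnk (x : ι → V) (supp : α → Set ι) (a : α) : ℕ := Module.finrank ℝ (spn x supp a)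

/-- generic perturbation -/
theorem generic (W : Submodule ℝ V) (Y : Set V) (hYf : Y.Finite) (hY : ∀ y ∈ Y, y ∉ W)
    (c0 : V →ₗ[ℝ] ℝ) (hc0 : W ≤ LinearMap.ker c0) :
    ∃ c : V →ₗ[ℝ] ℝ, W ≤ LinearMap.ker c ∧ ∀ y ∈ Y, c y ≠ 0 ∧ (0 < c0 y → 0 < c y) ∧ (c0 y < 0 → c y < 0) := by
  have := hYf.to_subtype
  obtain ⟨r, hr⟩ := Module.exists_dual_forall_apply_ne_zero (K := ℝ) (M := V ⧸ W)
    (fun y : Y => W.mkQ y.1) (fun y => by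
      simpa [Submodule.Quotient.mk_eq_zero] using hY y.1 y.2)
  have key : ∀ᶠ ε in nhdsWithin (0:ℝ) (Set.Ioi 0), ∀ y : Y, (c0 y + ε * r (W.mkQ y.1) ≠ 0 ∧
      (0 < c0 y → 0 < c0 y + ε * r (W.mkQ y.1)) ∧ (c0 y < 0 → c0 y + ε * r (W.mkQ y.1) < 0)) := by
    rw [Filter.eventually_all]
    intro y
    have ht : Filter.Tendsto (fun ε : ℝ => c0 y + ε * r (W.mkQ y.1)) (nhdsWithin 0 (Set.Ioi 0)) (nhds (c0 y)) := by
      have : Continuous (fun ε : ℝ => c0 y + ε * r (W.mkQ y.1)) := by fun_prop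
      have := this.tendsto 0
      simp only [zero_mul, add_zero] at this
      exact this.mono_left nhdsWithin_le_nhds
    rcases lt_trichotomy (c0 y.1) 0 with h | h | h
    · filter_upwards [ht.eventually_lt_const h] with ε hε
      exact ⟨hε.ne, fun h' => absurd h' (by linarith), fun _ => hε⟩
    · filter_upwards [self_mem_nhdsWithin] with ε hε
      refine ⟨?_, fun h' => absurd h' (by linarith), fun h' => absurd h' (by linarith)⟩
      rw [h, zero_add]
      exact mul_ne_zero (ne_of_gt hε) (hr y)
    · filter_upwards [ht.eventually_const_lt h] with ε hε
      exact ⟨hε.ne', fun _ => hε, fun h' => absurd h' (by linarith)⟩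
  obtain ⟨ε, hε⟩ := key.exists
  refine ⟨c0 + ε • (r.comp W.mkQ), ?_, ?_⟩
  · intro w hw
    have h1 : c0 w = 0 := hc0 hw
    have h2 : W.mkQ w = 0 := by simpa [Submodule.Quotient.mk_eq_zero] using hw
    rw [LinearMap.mem_ker, LinearMap.add_apply, LinearMap.smul_apply, LinearMap.comp_apply, h1, h2]
    simp
  · intro y hy
    have := hε ⟨y, hy⟩
    simpa using this

namespace Cfg
variable {x : ι → V} {supp : α → Set ι} {fn : α → (V →ₗ[ℝ] ℝ)} (C : Cfg x supp fn)
include C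

theorem fpos {a : α} {i : ι} (h : i ∉ supp a) : 0 < fn a (x i) :=
  lt_of_le_of_ne (C.nn a i) fun e => h ((C.zero a i).2 e.symm)

theorem spn_ker (a : α) : spn x supp a ≤ LinearMap.ker (fn a) := by
  unfold spn
  rw [Submodule.span_le]
  rintro _ ⟨i, hi, rfl⟩
  exact (C.zero a i).1 hi

theorem ker_of {c : V →ₗ[ℝ] ℝ} {a : α} (h : ∀ i ∈ supp a, c (x i) = 0) : spn x supp a ≤ LinearMap.ker c := by
  unfold spn
  rw [Submodule.span_le]
  rintro _ ⟨i, hi, rfl⟩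
  exact h i hi

theorem mem_spn (a : α) (i : ι) : i ∈ supp a ↔ x i ∈ spn x supp a := by
  constructor
  · intro h; exact Submodule.subset_span ⟨i, h, rfl⟩
  · intro h; exact (C.zero a i).2 (C.spn_ker a h)

theorem le_spn (a b : α) : a ≤ b ↔ spn x supp a ≤ spn x supp b := by
  constructor
  · intro h
    exact Submodule.span_mono (Set.image_mono ((C.le a b).1 h))
  · intro h
    rw [C.le]
    intro i hi
    rw [C.mem_spn] at hi ⊢
    exact h hi

theorem lt_spn {a b : α} : a < b ↔ spn x supp a < spn x supp b := by
  rw [lt_iff_le_not_ge, lt_iff_le_not_ge, ← C.le_spn, ← C.le_spn]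

theorem smono : StrictMono (rnk x supp) := by
  intro a b h
  exact Submodule.finrank_lt_finrank_of_lt (C.lt_spn.1 h)

theorem eq_of_spn {a b : α} (h : spn x supp a = spn x supp b) : a = b :=
  le_antisymm ((C.le_spn a b).2 h.le) ((C.le_spn b a).2 h.ge)

theorem exists_diff {a b : α} (h : a < b) : ∃ i, i ∈ supp b ∧ i ∉ supp a := by
  have := h.not_ge
  rw [C.le, Set.not_subset] at this
  exact this

theorem fin : Finite α := by
  refine Finite.of_injective supp ?_
  intro a b h
  exact le_antisymm ((C.le a b).2 h.le) ((C.le b a).2 h.ge)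

/-- faces of faces are faces -/
theorem face_in (b : α) (g : V →ₗ[ℝ] ℝ) (hg : ∀ i ∈ supp b, 0 ≤ g (x i)) :
    ∃ e, ∀ i, i ∈ supp e ↔ (i ∈ supp b ∧ g (x i) = 0) := by
  have key : ∀ᶠ t in Filter.atTop, ∀ i, i ∉ supp b → 0 < g (x i) + t * fn b (x i) := by
    rw [Filter.eventually_all]
    intro i
    by_cases hi : i ∈ supp b
    · exact Filter.Eventually.of_forall fun _ h => absurd hi h
    · have h1 := C.fpos hi
      have : Filter.Tendsto (fun t : ℝ => g (x i) + t * fn b (x i)) Filter.atTop Filter.atTop :=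
        Filter.tendsto_atTop_add_const_left _ _ (Filter.tendsto_id.atTop_mul_const h1)
      filter_upwards [this.eventually_gt_atTop 0] with t ht _ using ht
  obtain ⟨t, ht⟩ := key.exists
  have hv : ∀ i ∈ supp b, (g + t • fn b) (x i) = g (x i) := by
    intro i hi
    simp [(C.zero b i).1 hi]
  obtain ⟨e, he⟩ := C.all (g + t • fn b) (fun i => by
    by_cases hi : i ∈ supp b
    · rw [hv i hi]; exact hg i hi
    · simpa using (ht i hi).le)
  refine ⟨e, fun i => ?_⟩
  rw [he]
  by_cases hi : i ∈ supp b
  · rw [hv i hi]; simp [hi]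
  · have := ht i hi
    simp only [hi, false_and, iff_false]
    simpa using ne_of_gt this

/-- minimal ratio -/
theorem ratio {a b : α} (hab : a ≤ b) (c : V →ₗ[ℝ] ℝ) (hc : ∀ i ∈ supp a, c (x i) = 0)
    (i0 : ι) (h0 : i0 ∈ supp b) (h0' : i0 ∉ supp a) :
    ∃ (t : ℝ) (e : α), (∀ i ∈ supp b, t * fn a (x i) ≤ c (x i)) ∧ a < e ∧ e ≤ b ∧
      ∀ i, i ∈ supp e ↔ (i ∈ supp b ∧ c (x i) = t * fn a (x i)) := by
  obtain ⟨p, ⟨hp1, hp2⟩, hp3⟩ := Set.exists_min_image {i | i ∈ supp b ∧ i ∉ supp a}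
    (fun i => c (x i) / fn a (x i)) (Set.toFinite _) ⟨i0, h0, h0'⟩
  have hle : ∀ i ∈ supp b, c (x p) / fn a (x p) * fn a (x i) ≤ c (x i) := by
    intro i hi
    by_cases hia : i ∈ supp a
    · rw [hc i hia, (C.zero a i).1 hia, mul_zero]
    · rw [← le_div_iff₀ (C.fpos hia)]
      exact hp3 i ⟨hi, hia⟩
  obtain ⟨e, he⟩ := C.face_in b (c - (c (x p) / fn a (x p)) • fn a) (fun i hi => by
    have := hle i hi
    simpa using this)
  have he' : ∀ i, i ∈ supp e ↔ (i ∈ supp b ∧ c (x i) = c (x p) / fn a (x p) * fn a (x i)) := by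
    intro i
    rw [he]
    simp [sub_eq_zero]
  refine ⟨c (x p) / fn a (x p), e, hle, ?_, ?_, he'⟩
  · rw [lt_iff_le_not_ge, C.le, C.le]
    constructor
    · intro i hi
      rw [he']
      exact ⟨(C.le a b).1 hab hi, by rw [hc i hi, (C.zero a i).1 hi, mul_zero]⟩
    · intro hsub
      apply hp2
      apply hsub
      rw [he']
      exact ⟨hp1, by rw [div_mul_cancel₀ _ (C.fpos hp2).ne']⟩
  · rw [C.le]
    intro i hi
    exact ((he' i).1 hi).1

theorem interp {a b : α} (hab : a < b) (hr : rnk x supp a + 1 < rnk x supp b) : ∃ z, a < z ∧ z < b := by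
  obtain ⟨i, hib, hia⟩ := C.exists_diff hab
  have hlt : spn x supp a ⊔ Submodule.span ℝ {x i} < spn x supp b := by
    refine lt_of_le_of_ne (sup_le ((C.le_spn a b).1 hab.le) ?_) ?_
    · rw [Submodule.span_singleton_le_iff_mem]; exact (C.mem_spn b i).1 hib
    · intro heq
      have h1 := Submodule.finrank_add_le_finrank_add_finrank (spn x supp a) (Submodule.span ℝ {x i})
      rw [heq] at h1
      have h2 : Module.finrank ℝ (Submodule.span ℝ {x i}) ≤ 1 := by
        simpa using finrank_span_le_card (R := ℝ) ({x i} : Set V)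
      unfold rnk at hr
      omega
  have hj : ∃ j ∈ supp b, x j ∉ spn x supp a ⊔ Submodule.span ℝ {x i} := by
    by_contra hcon
    push Not at hcon
    apply hlt.not_ge
    unfold spn
    rw [Submodule.span_le]
    rintro _ ⟨j, hj, rfl⟩
    exact hcon j hj
  obtain ⟨j, hjb, hj⟩ := hj
  obtain ⟨c0, hc0, hker⟩ := Submodule.exists_le_ker_of_notMem hj
  have : ∃ c : V →ₗ[ℝ] ℝ, c (x j) < 0 ∧ spn x supp a ⊔ Submodule.span ℝ {x i} ≤ LinearMap.ker c := by
    rcases lt_or_gt_of_ne hc0 with h | h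
    · exact ⟨c0, h, hker⟩
    · refine ⟨-c0, by simpa using h, ?_⟩
      intro w hw
      have : c0 w = 0 := hker hw
      simp [this]
  obtain ⟨c, hcj, hker⟩ := this
  have hca : ∀ k ∈ supp a, c (x k) = 0 := fun k hk =>
    hker (Submodule.mem_sup_left ((C.mem_spn a k).1 hk))
  have hci : c (x i) = 0 := hker (Submodule.mem_sup_right (Submodule.mem_span_singleton_self _))
  obtain ⟨t, e, h1, h2, h3, h4⟩ := C.ratio hab.le c hca i hib hia
  refine ⟨e, h2, lt_of_le_of_ne h3 ?_⟩
  intro heq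
  have hie : i ∈ supp e := by rw [heq]; exact hib
  have hje : j ∈ supp e := by rw [heq]; exact hjb
  have e1 := ((h4 i).1 hie).2
  have e2 := ((h4 j).1 hje).2
  rw [hci] at e1
  have : t = 0 := by
    rcases mul_eq_zero.1 e1.symm with h | h
    · exact h
    · exact absurd h (C.fpos hia).ne'
  rw [this, zero_mul] at e2
  linarith

theorem atom_between {a b : α} (hab : a < b) : ∃ e, a < e ∧ e ≤ b ∧ rnk x supp e = rnk x supp a + 1 := by
  generalize hk : rnk x supp b = k
  induction k using Nat.strong_induction_on generalizing b with
  | _ k ih =>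
  have h1 := C.smono hab
  by_cases h : rnk x supp a + 1 < rnk x supp b
  · obtain ⟨z, hz1, hz2⟩ := C.interp hab h
    have := C.smono hz2
    obtain ⟨e, e1, e2, e3⟩ := ih (rnk x supp z) (by omega) hz1 rfl
    exact ⟨e, e1, e2.trans hz2.le, e3⟩
  · exact ⟨b, hab, le_rfl, by omega⟩

theorem spn_atom {a e : α} (hae : a < e) (hr : rnk x supp e = rnk x supp a + 1) {i : ι}
    (hi : i ∈ supp e) (hi' : i ∉ supp a) : spn x supp e = spn x supp a ⊔ Submodule.span ℝ {x i} := by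
  symm
  apply Submodule.eq_of_le_of_finrank_le
  · refine sup_le ((C.le_spn a e).1 hae.le) ?_
    rw [Submodule.span_singleton_le_iff_mem]; exact (C.mem_spn e i).1 hi
  · have : spn x supp a < spn x supp a ⊔ Submodule.span ℝ {x i} := by
      refine lt_of_le_of_ne le_sup_left ?_
      intro h
      apply hi'
      rw [C.mem_spn, h]
      exact Submodule.mem_sup_right (Submodule.mem_span_singleton_self _)
    have := Submodule.finrank_lt_finrank_of_lt this
    unfold rnk at hr
    omega

theorem atom_unique {a e e' : α} (hae : a < e) (hae' : a < e') (hr : rnk x supp e = rnk x supp a + 1)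
    (hr' : rnk x supp e' = rnk x supp a + 1) {i : ι} (hi : i ∈ supp e) (hi2 : i ∈ supp e')
    (hi' : i ∉ supp a) : e = e' :=
  C.eq_of_spn (by rw [C.spn_atom hae hr hi hi', C.spn_atom hae' hr' hi2 hi'])

theorem lin (v w e e' : α) (hvw : v ≠ w) (h1 : v < e) (h2 : v < e') (h3 : w < e) (h4 : w < e')
    (hr : rnk x supp w = rnk x supp v) (hr1 : rnk x supp e = rnk x supp v + 1)
    (hr2 : rnk x supp e' = rnk x supp v + 1) : e = e' := by
  have hnot : ¬ w ≤ v := by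
    intro h
    have := C.smono (lt_of_le_of_ne h hvw.symm)
    omega
  rw [C.le, Set.not_subset] at hnot
  obtain ⟨i, hi1, hi2⟩ := hnot
  exact C.atom_unique h1 h2 hr1 hr2 ((C.le _ _).1 h3.le hi1) ((C.le _ _).1 h4.le hi1) hi2

theorem diamond (a b : α) (hab : a < b) (hr : rnk x supp b = rnk x supp a + 2) :
    ∃ e1 e2 : α, e1 ≠ e2 ∧ ∀ z : α, (a < z ∧ z < b) ↔ (z = e1 ∨ z = e2) := by
  obtain ⟨e1, h1, h1b, hr1⟩ := C.atom_between hab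
  have h1b : e1 < b := lt_of_le_of_ne h1b (fun h => by rw [h] at hr1; omega)
  obtain ⟨j, hjb, hj1⟩ := C.exists_diff h1b
  obtain ⟨p, hp1, hpa⟩ := C.exists_diff h1
  have hja : j ∉ supp a := fun h => hj1 ((C.le _ _).1 h1.le h)
  have hpb := (C.le _ _).1 h1b.le hp1
  obtain ⟨t, e2, t1, t2, t3, t4⟩ := C.ratio hab.le (-fn e1) (fun i hi => by
    have := (C.zero e1 i).1 ((C.le _ _).1 h1.le hi)
    simp [this]) j hjb hja
  have ht : t < 0 := by
    have := t1 j hjb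
    have h2 := C.fpos hj1
    have h3 := C.fpos hja
    simp only [LinearMap.neg_apply] at this
    by_contra hcon
    push Not at hcon
    nlinarith [mul_nonneg hcon h3.le]
  have hp2 : p ∉ supp e2 := by
    intro h
    have := ((t4 p).1 h).2
    simp only [LinearMap.neg_apply] at this
    rw [(C.zero e1 p).1 hp1, neg_zero] at this
    rcases mul_eq_zero.1 this.symm with h | h
    · linarith
    · exact absurd h (C.fpos hpa).ne'
  have h2b : e2 < b := lt_of_le_of_ne t3 (fun h => hp2 (by rw [h]; exact hpb))
  have rk1 : ∀ z, a < z → z < b → rnk x supp z = rnk x supp a + 1 := by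
    intro z z1 z2
    have := C.smono z1
    have := C.smono z2
    omega
  have hr2 := rk1 e2 t2 h2b
  refine ⟨e1, e2, fun h => hp2 (by rw [← h]; exact hp1), fun z => ⟨?_, ?_⟩⟩
  · rintro ⟨z1, z2⟩
    have hrz := rk1 z z1 z2
    obtain ⟨i, hiz, hia⟩ := C.exists_diff z1
    by_cases hi1 : i ∈ supp e1
    · left; exact C.atom_unique z1 h1 hrz hr1 hiz hi1 hia
    by_cases hi2 : i ∈ supp e2
    · right; exact C.atom_unique z1 t2 hrz hr2 hiz hi2 hia
    exfalso
    obtain ⟨q, hq2, hqa⟩ := C.exists_diff t2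
    have hq1 : q ∉ supp e1 := by
      intro h
      have := C.atom_unique t2 h1 hr2 hr1 hq2 h hqa
      exact hp2 (by rw [this]; exact hp1)
    have hib := (C.le _ _).1 z2.le hiz
    have hqb := (C.le _ _).1 h2b.le hq2
    have hspan : spn x supp b = spn x supp a ⊔ Submodule.span ℝ {x p} ⊔ Submodule.span ℝ {x q} := by
      rw [← C.spn_atom h1 hr1 hp1 hpa]
      exact C.spn_atom h1b (by omega) hqb hq1
    have hxi := (C.mem_spn b i).1 hib
    rw [hspan, Submodule.mem_sup] at hxi
    obtain ⟨y, hy, z', hz', hsum⟩ := hxi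
    rw [Submodule.mem_sup] at hy
    obtain ⟨y0, hy0, y1, hy1, rfl⟩ := hy
    obtain ⟨l, rfl⟩ := Submodule.mem_span_singleton.1 hy1
    obtain ⟨m, rfl⟩ := Submodule.mem_span_singleton.1 hz'
    have va : ∀ e, a < e → fn e y0 = 0 := by
      intro e he
      exact C.spn_ker e ((C.le_spn a e).1 he.le hy0)
    have va0 : fn a y0 = 0 := C.spn_ker a hy0
    -- first functional
    have f1 : fn e1 (x i) = m * fn e1 (x q) := by
      rw [← hsum]; simp [va e1 h1, (C.zero e1 p).1 hp1]
    have hm : 0 < m := by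
      have g1 := C.fpos hi1
      have g2 := C.fpos hq1
      rw [f1] at g1
      exact pos_of_mul_pos_left g1 g2.le
    have f2 : -fn e1 (x i) - t * fn a (x i) = l * (-fn e1 (x p) - t * fn a (x p)) := by
      have hq := ((t4 q).1 hq2).2
      simp only [LinearMap.neg_apply] at hq
      rw [← hsum]
      simp only [map_add, map_smul, va e1 h1, va0, smul_eq_mul]
      linear_combination m * hq
    have hl : 0 < l := by
      have g1 : 0 < -fn e1 (x i) - t * fn a (x i) := by
        have := t1 i hib
        simp only [LinearMap.neg_apply] at this
        refine lt_of_le_of_ne (by linarith) ?_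
        intro h
        apply hi2
        rw [t4]
        exact ⟨hib, by simp only [LinearMap.neg_apply]; linarith⟩
      have g2 : 0 ≤ -fn e1 (x p) - t * fn a (x p) := by
        have := t1 p hpb
        simp only [LinearMap.neg_apply] at this
        linarith
      rw [f2] at g1
      exact pos_of_mul_pos_left g1 g2
    have f3 : fn z (x i) = l * fn z (x p) + m * fn z (x q) := by
      rw [← hsum]; simp [va z z1]
    rw [(C.zero z i).1 hiz] at f3
    have hzp : fn z (x p) = 0 := by
      have g1 := C.nn z p
      have g2 := C.nn z q
      have := mul_nonneg hm.le g2
      have := mul_nonneg hl.le g1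
      have : l * fn z (x p) = 0 := by linarith
      rcases mul_eq_zero.1 this with h | h
      · linarith
      · exact h
    have := C.atom_unique z1 h1 hrz hr1 ((C.zero z p).2 hzp) hp1 hpa
    exact hi1 (by rw [← this]; exact hiz)
  · rintro (rfl | rfl)
    · exact ⟨h1, h1b⟩
    · exact ⟨t2, h2b⟩

end Cfg
end Geometry


section Geometry2
variable {ι V : Type*} [Finite ι] [AddCommGroup V] [Module ℝ V] [FiniteDimensional ℝ V]

/-- height of an atom over `F` with respect to `c` -/
noncomputable def hgt (x : ι → V) (supp : α → Set ι) (fn : α → (V →ₗ[ℝ] ℝ)) (c : V →ₗ[ℝ] ℝ) (F v : α) : ℝ :=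
  if h : ∃ i, i ∈ supp v ∧ i ∉ supp F then c (x h.choose) / fn F (x h.choose) else 0

namespace Cfg
variable {x : ι → V} {supp : α → Set ι} {fn : α → (V →ₗ[ℝ] ℝ)} (C : Cfg x supp fn)
include C

theorem hgt_spec {F v : α} (hF : F < v) (hr : rnk x supp v = rnk x supp F + 1) (c : V →ₗ[ℝ] ℝ)
    (hc : spn x supp F ≤ LinearMap.ker c) {j : ι} (hj : j ∈ supp v) :
    c (x j) = hgt x supp fn c F v * fn F (x j) := by
  have hex := C.exists_diff hF
  unfold hgt
  rw [dif_pos hex]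
  obtain ⟨h1, h2⟩ := hex.choose_spec
  generalize hex.choose = i at h1 h2
  have hsp := C.spn_atom hF hr h1 h2
  have hpos := C.fpos h2
  have hle : spn x supp v ≤ LinearMap.ker (c - (c (x i) / fn F (x i)) • fn F) := by
    rw [hsp]
    refine sup_le ?_ ?_
    · intro w hw
      have e1 : c w = 0 := hc hw
      have e2 : fn F w = 0 := C.spn_ker F hw
      simp [e1, e2]
    · rw [Submodule.span_singleton_le_iff_mem]
      simp [div_mul_cancel₀ _ hpos.ne']
  have := hle ((C.mem_spn v j).1 hj)
  rw [LinearMap.mem_ker] at this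
  simp only [LinearMap.sub_apply, LinearMap.smul_apply, smul_eq_mul] at this
  linarith

/-- genericity of `c` over `F` -/
theorem sweep_of (F : α) (c : V →ₗ[ℝ] ℝ) (hc : spn x supp F ≤ LinearMap.ker c)
    (hgen : ∀ i j, (fn F (x j) • x i - fn F (x i) • x j) ∉ spn x supp F →
      c (fn F (x j) • x i - fn F (x i) • x j) ≠ 0) :
    SweepDown (rnk x supp) F (hgt x supp fn c F) := by
  constructor
  · intro u v hu hv ru rv heq
    obtain ⟨i, hi1, hi2⟩ := C.exists_diff hu
    obtain ⟨j, hj1, hj2⟩ := C.exists_diff hv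
    by_contra hne
    have e1 := C.hgt_spec hu ru c hc hi1
    have e2 := C.hgt_spec hv rv c hc hj1
    refine hgen i j ?_ ?_
    · intro hmem
      have : x i ∈ spn x supp v := by
        have hj3 := (C.mem_spn v j).1 hj1
        have h1 := (C.le_spn F v).1 hv.le hmem
        have h2 := Submodule.add_mem _ h1 (Submodule.smul_mem _ (fn F (x i)) hj3)
        rw [sub_add_cancel] at h2
        exact (Submodule.smul_mem_iff _ (C.fpos hj2).ne').1 h2
      exact hne (C.atom_unique hu hv ru rv hi1 ((C.mem_spn v i).2 this) hi2)
    · simp only [map_sub, map_smul, smul_eq_mul]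
      rw [e1, e2, heq]; ring
  · intro T v w hv rv hvT hw rw' hwT hlt
    obtain ⟨j, hj1, hj2⟩ := C.exists_diff hw
    obtain ⟨c', hc'⟩ : ∃ c', c' = c - hgt x supp fn c F v • fn F := ⟨_, rfl⟩
    have hc'v : ∀ y, c' y = c y - hgt x supp fn c F v * fn F y := by intro y; rw [hc']; simp
    have hz : ∀ i ∈ supp v, c' (x i) = 0 := by
      intro i hi
      rw [hc'v, C.hgt_spec hv rv c hc hi]; ring
    have hval : ∀ u, F < u → rnk x supp u = rnk x supp F + 1 → ∀ i ∈ supp u,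
        c' (x i) = (hgt x supp fn c F u - hgt x supp fn c F v) * fn F (x i) := by
      intro u hu ru i hi
      rw [hc'v, C.hgt_spec hu ru c hc hi]; ring
    have hjn : c' (x j) < 0 := by
      rw [hval w hw rw' j hj1]
      exact mul_neg_of_neg_of_pos (by linarith) (C.fpos hj2)
    have hjv : j ∉ supp v := fun h => by rw [hz j h] at hjn; exact lt_irrefl _ hjn
    have hjT := (C.le _ _).1 hwT hj1
    obtain ⟨t, E, t1, t2, t3, t4⟩ := C.ratio hvT c' hz j hjT hjv
    have ht : t < 0 := by
      have h1 := t1 j hjT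
      have h2 := C.fpos hjv
      by_contra hcon
      push Not at hcon
      nlinarith [mul_nonneg hcon h2.le]
    obtain ⟨e, e1, e2, e3⟩ := C.atom_between t2
    obtain ⟨p, q, hpq, hd⟩ := C.diamond F e (hv.trans e1) (by omega)
    have hvd := (hd v).1 ⟨hv, e1⟩
    obtain ⟨u, hu1, hu2, huv⟩ : ∃ u, F < u ∧ u < e ∧ u ≠ v := by
      by_cases hp : p = v
      · exact ⟨q, ((hd q).2 (Or.inr rfl)).1, ((hd q).2 (Or.inr rfl)).2, fun h => hpq (by rw [hp, h])⟩
      · exact ⟨p, ((hd p).2 (Or.inl rfl)).1, ((hd p).2 (Or.inl rfl)).2, hp⟩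
    have ru : rnk x supp u = rnk x supp F + 1 := by
      have := C.smono hu1
      have := C.smono hu2
      omega
    refine ⟨e, u, e1, hu2, e2.trans t3, by omega, hu1, ru, ?_⟩
    obtain ⟨i, hi1, hi2⟩ := C.exists_diff hu1
    have hiv : i ∉ supp v := fun h => huv (C.atom_unique hu1 hv ru rv hi1 h hi2)
    have hiE := (C.le _ _).1 (hu2.le.trans e2) hi1
    have := ((t4 i).1 hiE).2
    rw [hval u hu1 ru i hi1] at this
    have h1 := mul_neg_of_neg_of_pos ht (C.fpos hiv)
    rw [← this] at h1
    have h2 := C.fpos hi2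
    by_contra hcon
    push Not at hcon
    nlinarith [mul_nonneg (sub_nonneg.2 hcon) h2.le]

/-- existence of generic functionals -/
theorem exists_gen (F : α) (c0 : V →ₗ[ℝ] ℝ) (hc0 : spn x supp F ≤ LinearMap.ker c0) :
    ∃ c : V →ₗ[ℝ] ℝ, spn x supp F ≤ LinearMap.ker c ∧
      (∀ i j, (fn F (x j) • x i - fn F (x i) • x j) ∉ spn x supp F →
        c (fn F (x j) • x i - fn F (x i) • x j) ≠ 0) ∧
      ∀ i, (0 < c0 (x i) → 0 < c (x i)) ∧ (c0 (x i) < 0 → c (x i) < 0) := by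
  obtain ⟨c, h1, h2⟩ := generic (spn x supp F)
    ((Set.range x ∪ Set.range (fun p : ι × ι => fn F (x p.2) • x p.1 - fn F (x p.1) • x p.2)) \ (spn x supp F : Set V))
    (((Set.finite_range _).union (Set.finite_range _)).sdiff) (fun y hy => hy.2) c0 hc0
  refine ⟨c, h1, fun i j hij => (h2 _ ⟨Or.inr ⟨(i, j), rfl⟩, hij⟩).1, fun i => ?_⟩
  by_cases hi : x i ∈ spn x supp F
  · have : c0 (x i) = 0 := hc0 hi
    rw [this]
    exact ⟨fun h => absurd h (lt_irrefl _), fun h => absurd h (lt_irrefl _)⟩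
  · exact (h2 _ ⟨Or.inl ⟨i, rfl⟩, hi⟩).2

theorem sweep (F : α) : ∃ h, SweepDown (rnk x supp) F h ∧ SweepDown (rnk x supp) F (fun y => - h y) ∧
    ∀ v, F < v → rnk x supp v = rnk x supp F + 1 → ∃ h', SweepDown (rnk x supp) v h' ∧
      ∀ e u, v < e → rnk x supp e = rnk x supp F + 2 → F < u → rnk x supp u = rnk x supp F + 1 → u < e → u ≠ v →
        (h u < h v ↔ h' e < 0) := by
  obtain ⟨c, hc1, hc2, -⟩ := C.exists_gen F 0 (by intro w _; simp)
  have s1 := C.sweep_of F c hc1 hc2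
  refine ⟨hgt x supp fn c F, s1, ?_, ?_⟩
  · have := C.sweep_of F (-c) (by
      intro w hw
      have : c w = 0 := hc1 hw
      simp [this]) (fun i j h => by
        rw [LinearMap.neg_apply]
        exact neg_ne_zero.2 (hc2 i j h))
    have heq : hgt x supp fn (-c) F = fun y => - hgt x supp fn c F y := by
      funext y
      unfold hgt
      split_ifs
      · rw [LinearMap.neg_apply, neg_div]
      · simp
    rwa [heq] at this
  · intro v hv rv
    obtain ⟨c', hc'⟩ : ∃ c', c' = c - hgt x supp fn c F v • fn F := ⟨_, rfl⟩
    have hc'v : ∀ y, c' y = c y - hgt x supp fn c F v * fn F y := by intro y; rw [hc']; simp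
    have hval : ∀ u, F < u → rnk x supp u = rnk x supp F + 1 → ∀ i ∈ supp u,
        c' (x i) = (hgt x supp fn c F u - hgt x supp fn c F v) * fn F (x i) := by
      intro u hu ru i hi
      rw [hc'v, C.hgt_spec hu ru c hc1 hi]; ring
    obtain ⟨d, hd1, hd2, hd3⟩ := C.exists_gen v c' (C.ker_of fun i hi => by
      rw [hval v hv rv i hi]; ring)
    refine ⟨hgt x supp fn d v, C.sweep_of v d hd1 hd2, ?_⟩
    intro e u hve re hu ru hue huv
    obtain ⟨j, hj1, hj2⟩ := C.exists_diff hu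
    have hjv : j ∉ supp v := fun h => huv (C.atom_unique hu hv ru rv hj1 h hj2)
    have hje := (C.le _ _).1 hue.le hj1
    have e1 := hval u hu ru j hj1
    have e2 := C.hgt_spec hve (by omega) d hd1 hje
    have p1 := C.fpos hj2
    have p2 := C.fpos hjv
    have hne : hgt x supp fn c F u ≠ hgt x supp fn c F v := fun h => huv (s1.1 u v hu hv ru rv h)
    constructor
    · intro h
      have := (hd3 j).2 (by rw [e1]; exact mul_neg_of_neg_of_pos (by linarith) p1)
      rw [e2] at this
      by_contra hcon
      push Not at hcon
      nlinarith [mul_nonneg hcon p2.le]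
    · intro h
      by_contra hcon
      push Not at hcon
      have hlt := lt_of_le_of_ne hcon hne.symm
      have := (hd3 j).1 (by rw [e1]; exact mul_pos (by linarith) p1)
      rw [e2] at this
      nlinarith [mul_pos (neg_pos.2 h) p2]

theorem toPP : PP (rnk x supp) (Module.finrank ℝ (Submodule.span ℝ (Set.range x))) where
  fin := C.fin
  bot := by
    obtain ⟨f, hf⟩ := C.pos
    obtain ⟨b, hb⟩ := C.all f fun i => (hf i).le
    have : supp b = ∅ := by
      ext i; rw [hb]; simp [(hf i).ne']
    refine ⟨b, by unfold rnk spn; rw [this]; simp, fun y => by rw [C.le, this]; exact Set.empty_subset _⟩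
  top := by
    obtain ⟨b, hb⟩ := C.all 0 fun i => le_rfl
    have : supp b = Set.univ := by
      ext i; rw [hb]; simp
    refine ⟨b, by unfold rnk spn; rw [this, Set.image_univ], fun y => by rw [C.le, this]; exact Set.subset_univ _⟩
  smono := C.smono
  interp := fun _ _ => C.interp
  diamond := C.diamond
  lin := C.lin
  sweep := C.sweep

end Cfg
end Geometry2


theorem finrank_cone {E : Type*} [AddCommGroup E] [Module ℝ E] [FiniteDimensional ℝ E]
    (A : Set E) (hA : A.Nonempty) :
    Module.finrank ℝ (Submodule.span ℝ ((fun y : E => ((y, 1) : E × ℝ)) '' A)) =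
      Module.finrank ℝ (vectorSpan ℝ A) + 1 := by
  obtain ⟨s, hs⟩ := hA
  let L : (vectorSpan ℝ A) × ℝ →ₗ[ℝ] E × ℝ :=
    LinearMap.coprod ((LinearMap.inl ℝ E ℝ).comp (vectorSpan ℝ A).subtype)
      (LinearMap.toSpanSingleton ℝ _ (s, 1))
  have hLa : ∀ w r, L (w, r) = ((w : E) + r • s, r) := by
    intro w r
    simp [L]
  have hinj : Function.Injective L := by
    rintro ⟨w, r⟩ ⟨w', r'⟩ h
    rw [hLa, hLa] at h
    obtain ⟨h1, h2⟩ := Prod.mk.inj h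
    subst h2
    have := add_right_cancel h1
    rw [Subtype.ext this]
  have hr : LinearMap.range L = Submodule.span ℝ ((fun y : E => ((y, 1) : E × ℝ)) '' A) := by
    apply le_antisymm
    · rintro _ ⟨⟨⟨w, hw⟩, r⟩, rfl⟩
      rw [hLa]
      have h0 : ((w + r • s, r) : E × ℝ) = (w, 0) + r • (s, 1) := by simp
      have hsm : ((s, 1) : E × ℝ) ∈ Submodule.span ℝ ((fun y : E => ((y, 1) : E × ℝ)) '' A) :=
        Submodule.subset_span ⟨s, hs, rfl⟩
      show ((w + r • s, r) : E × ℝ) ∈ _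
      rw [h0]
      refine Submodule.add_mem _ ?_ (Submodule.smul_mem _ _ hsm)
      have hle : vectorSpan ℝ A ≤ (Submodule.span ℝ ((fun y : E => ((y, 1) : E × ℝ)) '' A)).comap
          (LinearMap.inl ℝ E ℝ) := by
        rw [vectorSpan_eq_span_vsub_set_right ℝ hs, Submodule.span_le]
        rintro _ ⟨y, hy, rfl⟩
        have hym : ((y, 1) : E × ℝ) ∈ Submodule.span ℝ ((fun y : E => ((y, 1) : E × ℝ)) '' A) :=
          Submodule.subset_span ⟨y, hy, rfl⟩
        have := Submodule.sub_mem _ hym hsm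
        simpa using this
      exact hle hw
    · rw [Submodule.span_le]
      rintro _ ⟨y, hy, rfl⟩
      refine ⟨(⟨y -ᵥ s, vsub_mem_vectorSpan ℝ hy hs⟩, 1), ?_⟩
      rw [hLa]
      simp
  rw [← hr, LinearMap.finrank_range_of_inj hinj, Module.finrank_prod]
  simp

section Bridge
variable {d : ℕ} {P : Set (EucSp d)} {S : Finset (EucSp d)}

theorem face_eq_hull (hS : P = convexHull ℝ (S : Set (EucSp d))) {F : Set (EucSp d)} (hF : IsExposed ℝ P F) :
    F = convexHull ℝ (F ∩ (S : Set (EucSp d))) := by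
  have hPc : IsCompact P := hS ▸ S.finite_toSet.isCompact_convexHull ℝ
  have hPv : Convex ℝ P := hS ▸ convex_convexHull ℝ _
  have hFc := hF.isCompact hPc
  have hFv := hF.convex hPv
  apply Set.Subset.antisymm
  · have h1 := closure_convexHull_extremePoints hFc hFv
    have h2 : Set.extremePoints ℝ F ⊆ F ∩ (S : Set (EucSp d)) := by
      intro y hy
      refine ⟨extremePoints_subset hy, ?_⟩
      have h3 := hF.isExtreme.extremePoints_subset_extremePoints hy
      rw [hS] at h3
      exact extremePoints_convexHull_subset h3
    calc F = closure (convexHull ℝ (Set.extremePoints ℝ F)) := h1.symm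
      _ ⊆ closure (convexHull ℝ (F ∩ (S : Set (EucSp d)))) := closure_mono (convexHull_mono h2)
      _ = _ := ((S.finite_toSet.inter_of_right F).isClosed_convexHull ℝ).closure_eq
  · exact convexHull_min Set.inter_subset_left hFv

/-- The vectors of the cone. -/
noncomputable def cx (S : Finset (EucSp d)) : S → EucSp d × ℝ := fun s => (s.1, 1)

/-- The generators on a face. -/
def csupp (S : Finset (EucSp d)) (F : Faces P) : Set S := {s | s.1 ∈ F.1}

theorem cx_image (F : Faces P) :
    cx S '' csupp S F = (fun y : EucSp d => ((y, 1) : EucSp d × ℝ)) '' (F.1 ∩ (S : Set (EucSp d))) := by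
  ext y
  constructor
  · rintro ⟨s, hs, rfl⟩
    exact ⟨s.1, ⟨hs, s.2⟩, rfl⟩
  · rintro ⟨y, ⟨h1, h2⟩, rfl⟩
    exact ⟨⟨y, h2⟩, h1, rfl⟩

theorem exists_fn (hS : P = convexHull ℝ (S : Set (EucSp d))) (F : Faces P) :
    ∃ f : (EucSp d × ℝ) →ₗ[ℝ] ℝ, (∀ i, 0 ≤ f (cx S i)) ∧ ∀ i, i ∈ csupp S F ↔ f (cx S i) = 0 := by
  have hSP : (S : Set (EucSp d)) ⊆ P := hS ▸ subset_convexHull ℝ _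
  by_cases hne : F.1.Nonempty
  · obtain ⟨p, hp⟩ := hne
    obtain ⟨l, hl⟩ := F.2 ⟨p, hp⟩
    have hpP : p ∈ P ∧ ∀ y ∈ P, l y ≤ l p := by
      rw [hl] at hp; exact hp
    refine ⟨(l p) • LinearMap.snd ℝ _ _ - (l : EucSp d →ₗ[ℝ] ℝ).comp (LinearMap.fst ℝ _ _), ?_, ?_⟩
    · intro i
      have := hpP.2 i.1 (hSP i.2)
      simp [cx]
      exact this
    · intro i
      have h1 := hpP.2 i.1 (hSP i.2)
      have : i ∈ csupp S F ↔ i.1 ∈ P ∧ ∀ y ∈ P, l y ≤ l i.1 := by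
        show i.1 ∈ F.1 ↔ _
        rw [hl]; rfl
      rw [this]
      simp only [cx, LinearMap.sub_apply, LinearMap.smul_apply, LinearMap.snd_apply, LinearMap.comp_apply,
        LinearMap.fst_apply, smul_eq_mul, mul_one, ContinuousLinearMap.coe_coe]
      constructor
      · rintro ⟨_, h⟩
        have := h p hpP.1
        linarith
      · intro h
        refine ⟨hSP i.2, fun y hy => ?_⟩
        have := hpP.2 y hy
        linarith
  · refine ⟨LinearMap.snd ℝ _ _, ?_, ?_⟩
    · intro i; simp [cx]
    · intro i
      simp only [cx, LinearMap.snd_apply, one_ne_zero, iff_false]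
      exact fun h => hne ⟨_, h⟩

theorem exists_face (hS : P = convexHull ℝ (S : Set (EucSp d))) (f : (EucSp d × ℝ) →ₗ[ℝ] ℝ)
    (hf : ∀ i, 0 ≤ f (cx S i)) : ∃ F : Faces P, ∀ i, i ∈ csupp S F ↔ f (cx S i) = 0 := by
  have hSP : (S : Set (EucSp d)) ⊆ P := hS ▸ subset_convexHull ℝ _
  let g : EucSp d →ₗ[ℝ] ℝ := f.comp (LinearMap.inl ℝ _ _)
  have hg : ∀ y, f (y, 1) = g y + f (0, 1) := by
    intro y
    have : ((y, 1) : EucSp d × ℝ) = (y, 0) + (0, 1) := by simp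
    rw [this, map_add]; rfl
  have hnn : ∀ y ∈ P, 0 ≤ g y + f (0, 1) := by
    have hc : Convex ℝ {y | - f (0, 1) ≤ g y} := convex_halfSpace_ge g.isLinear _
    have : P ⊆ {y | - f (0, 1) ≤ g y} := by
      rw [hS]
      apply convexHull_min _ hc
      intro y hy
      have := hf ⟨y, hy⟩
      have h2 : f (cx S ⟨y, hy⟩) = g y + f (0, 1) := hg y
      rw [h2] at this
      simp only [Set.mem_ofPred_eq]
      linarith
    intro y hy
    have := this hy
    simp only [Set.mem_ofPred_eq] at this
    linarith
  refine ⟨⟨{y | y ∈ P ∧ g y + f (0, 1) = 0}, ?_⟩, ?_⟩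
  · rintro ⟨p, hp, hp0⟩
    refine ⟨LinearMap.toContinuousLinearMap (-g), ?_⟩
    ext y
    simp only [Set.mem_ofPred_eq, LinearMap.coe_toContinuousLinearMap', LinearMap.neg_apply]
    constructor
    · rintro ⟨h1, h2⟩
      refine ⟨h1, fun z hz => ?_⟩
      have := hnn z hz
      linarith
    · rintro ⟨h1, h2⟩
      refine ⟨h1, ?_⟩
      have := h2 p hp
      have := hnn y h1
      linarith
  · intro i
    have h2 : f (cx S i) = g i.1 + f (0, 1) := hg i.1
    rw [h2]
    constructor
    · intro h; exact h.2
    · intro h; exact ⟨hSP i.2, h⟩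

theorem exists_PP (hP : IsConvexPolytope P) :
    ∃ ρ : Faces P → ℕ, PP ρ (d + 1) ∧ ∀ F, faceRank F = (ρ F : ℤ) - 1 := by
  obtain ⟨⟨S, hS⟩, hinter⟩ := hP
  choose fn hfn1 hfn2 using exists_fn (S := S) hS
  have C : Cfg (cx S) (csupp (P := P) S) fn := by
    refine ⟨?_, hfn1, hfn2, exists_face hS, ⟨LinearMap.snd ℝ _ _, fun i => by simp [cx]⟩⟩
    intro F G
    constructor
    · intro h i hi
      exact h hi
    · intro h
      show F.1 ⊆ G.1
      rw [face_eq_hull hS F.2, face_eq_hull hS G.2]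
      apply convexHull_mono
      rintro y ⟨h1, h2⟩
      exact ⟨h (show (⟨y, h2⟩ : S) ∈ csupp S F from h1), h2⟩
  have hn : Module.finrank ℝ (Submodule.span ℝ (Set.range (cx S))) = d + 1 := by
    have hr : Set.range (cx S) = (fun y : EucSp d => ((y, 1) : EucSp d × ℝ)) '' (S : Set (EucSp d)) := by
      ext y
      constructor
      · rintro ⟨s, rfl⟩
        exact ⟨s.1, s.2, rfl⟩
      · rintro ⟨y, h2, rfl⟩
        exact ⟨⟨y, h2⟩, rfl⟩
    have hne : (S : Set (EucSp d)).Nonempty := by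
      rw [← convexHull_nonempty_iff (𝕜 := ℝ), ← hS]
      exact hinter.mono interior_subset
    rw [hS, interior_convexHull_nonempty_iff_affineSpan_eq_top] at hinter
    rw [hr, finrank_cone _ hne, ← direction_affineSpan, hinter, AffineSubspace.direction_top]
    simp
  refine ⟨rnk (cx S) (csupp S), hn ▸ C.toPP, ?_⟩
  intro F
  unfold faceRank rnk spn
  rw [cx_image]
  split_ifs with h
  · rw [h, Set.empty_inter, Set.image_empty, Submodule.span_empty, finrank_bot]; rfl
  · have hF := face_eq_hull hS F.2
    have hne : (F.1 ∩ (S : Set (EucSp d))).Nonempty := by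
      rw [← convexHull_nonempty_iff (𝕜 := ℝ), ← hF]
      exact Set.nonempty_iff_ne_empty.2 h
    rw [finrank_cone _ hne, ← direction_affineSpan, ← affineSpan_convexHull (F.1 ∩ (S : Set (EucSp d))), ← hF,
      Nat.cast_add, Nat.cast_one, add_sub_cancel_right]

end Bridge

theorem PP.flag_of (Q : PP ρ n) (a : Fl ρ n) : ∃ Φ : Flag α, Set.range a.f = (Φ : Set α) := by
  have hc : IsChain (· ≤ ·) (Set.range a.f) := by
    rintro _ ⟨i, rfl⟩ _ ⟨j, rfl⟩ _
    rcases le_total i j with h | h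
    · exact Or.inl (a.mono h)
    · exact Or.inr (a.mono h)
  obtain ⟨Φ, hΦ⟩ := hc.exists_subset_flag
  obtain ⟨b, hb⟩ := Q.exists_fl Φ
  refine ⟨Φ, ?_⟩
  have : a = b := by
    apply Fl.ext'
    intro i
    by_cases hi : i ≤ n
    · have h1 : a i ∈ Set.range b.f := by rw [hb]; exact hΦ ⟨i, rfl⟩
      have h2 := Q.fl_eq_of_range h1
      rw [a.rk, min_eq_left hi] at h2
      exact h2.symm
    · exact Q.fl_top a b (by omega) (by omega)
  rw [this, hb]

theorem PP.same_iff (Q : PP ρ n) {a b : Fl ρ n} {Φ Ψ : Flag α} (ha : Set.range a.f = (Φ : Set α))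
    (hb : Set.range b.f = (Ψ : Set α)) : SameFlagOrbit Φ Ψ ↔ Eqv a b := by
  unfold SameFlagOrbit Eqv
  rw [← ha, ← hb]
  refine exists_congr fun γ => ?_
  constructor
  · intro h i
    have hm : γ (a i) ∈ Set.range b.f := by
      rw [← h]; exact ⟨_, ⟨i, rfl⟩, rfl⟩
    have h2 := Q.fl_eq_of_range hm
    rw [Q.aut_rank, a.rk] at h2
    rw [← h2]
    rcases le_total i n with hi | hi
    · rw [min_eq_left hi]
    · rw [min_eq_right hi]
      exact Q.fl_top b b le_rfl hi
  · intro h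
    rw [← Set.range_comp]
    congr 1
    exact funext h

theorem PP.final (Q : PP ρ (n + 1)) (rk : α → ℤ) (hrk : ∀ x, rk x = (ρ x : ℤ) - 1) (I : Set ℕ)
    (h2 : InClass rk n I) (j : ℕ) (hj : j < n) (hjI : j ∉ I) : j = 0 ∨ j = n - 1 := by
  by_contra hcon
  push Not at hcon
  obtain ⟨⟨Φ, Ψ, hne, hor⟩, hcl⟩ := h2
  obtain ⟨a, ha⟩ := Q.exists_fl Φ
  obtain ⟨b, hb⟩ := Q.exists_fl Ψ
  refine Q.abs {k | k - 1 ∈ I} ⟨a, b, ?_, ?_⟩ ?_ (j + 1) (by omega) (by omega) ?_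
  · rwa [← Q.same_iff ha hb]
  · intro Ω
    obtain ⟨Θ, hΘ⟩ := Q.flag_of Ω
    rw [← Q.same_iff hΘ ha, ← Q.same_iff hΘ hb]
    exact hor Θ
  · intro Ω k hk1 hkn
    obtain ⟨Θ, hΘ⟩ := Q.flag_of Ω
    obtain ⟨Θ', hΘ'⟩ := Q.flag_of (sw k Ω)
    rw [← Q.same_iff hΘ hΘ']
    refine hcl Θ Θ' (k - 1) (by omega) ⟨?_, ?_⟩
    · intro h
      apply Q.sw_ne k hk1 hkn Ω
      have hr : Set.range (sw k Ω).f = Set.range Ω.f := by rw [hΘ, hΘ', h]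
      apply Fl.ext'
      intro i
      by_cases hi : i ≤ n + 1
      · have h1 : Ω i ∈ Set.range (sw k Ω).f := by rw [hr]; exact ⟨i, rfl⟩
        have h2 := Q.fl_eq_of_range h1
        rw [Ω.rk, min_eq_left hi] at h2
        exact h2
      · exact Q.fl_top _ _ (by omega) (by omega)
    · intro x hx
      rw [hrk] at hx
      have hxk : ρ x ≠ k := by
        intro h
        apply hx
        rw [h]
        omega
      show x ∈ (Θ : Set α) ↔ x ∈ (Θ' : Set α)
      rw [← hΘ, ← hΘ']
      constructor
      · intro h
        have := Q.fl_eq_of_range h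
        exact ⟨ρ x, by rw [sw_of_ne k Ω _ hxk]; exact this⟩
      · intro h
        have := Q.fl_eq_of_range h
        rw [sw_of_ne k Ω _ hxk] at this
        exact ⟨ρ x, this⟩
  · simpa using hjI

/-- If a convex `d`-polytope is combinatorially two-orbit of class `2_I`
and `j ∈ {0, …, d-1}` with `j ∉ I`, then `j = 0` or `j = d - 1`. -/
theorem vertex_or_facet_intransitive {d : ℕ} (P : Set (EucSp d)) (hP : IsConvexPolytope P)
    (I : Set ℕ) (hI : I ⊆ Set.Iio d)
    (h2 : InClass (faceRank (P := P)) d I)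
    (j : ℕ) (hj : j < d) (hjI : j ∉ I) :
    j = 0 ∨ j = d - 1 := by
  obtain ⟨ρ, Q, hρ⟩ := exists_PP hP
  exact Q.final _ hρ I h2 j hj hjI
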